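/- Let K ⊂ ℝⁿ be a convex body of class C²₊, let u₀ ∈ ℝⁿ be a fixed vector, and define ψ(x) = (ν_K(x), u₀) for x ∈ ∂K. Then ∫_{∂K} ψ dℋ^{n-1} = 0 and equality holds in the main inequality: ∫_{∂K} tr(Dν_K) ψ² dℋ^{n-1} = ∫_{∂K} ((Dν_K)^{-1} ∇ψ, ∇ψ) dℋ^{n-1}. -/

import Mathlib

open MeasureTheory Metric
open scoped RealInnerProductSpace ENNReal

noncomputable section

/-- Euclidean `n`-space. -/
abbrev E (n : ℕ) : Type := EuclideanSpace ℝ (Fin n)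

/-- Orthogonal projection onto the hyperplane orthogonal to the unit vector `u`
(the tangent space at a boundary point with outer unit normal `u`). -/
noncomputable def tproj {n : ℕ} (u : E n) : E n →L[ℝ] E n :=
  ContinuousLinearMap.id ℝ (E n) - (innerSL ℝ u).smulRight u

section ConvexBodies

open Filter Topology Set
open scoped NNReal

/-- The linear map `ℝ^{d+1} → ℝ^d` deleting the `i`-th coordinate. -/
def dropCoord {d : ℕ} (i : Fin (d + 1)) : E (d + 1) →ₗ[ℝ] E d where
  toFun x := WithLp.toLp 2 fun k => x (i.succAbove k)
  map_add' _ _ := rfl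
  map_smul' _ _ := rfl

/-- The point of `ℝ^{d+1}` with `i`-th coordinate `t` and remaining coordinates `y`. -/
def insertCoord {d : ℕ} (i : Fin (d + 1)) (t : ℝ) (y : E d) : E (d + 1) :=
  WithLp.toLp 2 (i.insertNth t y)

section Coordinates

variable {d : ℕ} (i : Fin (d + 1))

@[simp] lemma dropCoord_apply (x : E (d + 1)) (k : Fin d) :
    dropCoord i x k = x (i.succAbove k) := rfl

@[simp] lemma insertCoord_apply_self (t : ℝ) (y : E d) : insertCoord i t y i = t := by
  simp [insertCoord]

@[simp] lemma insertCoord_apply_succAbove (t : ℝ) (y : E d) (k : Fin d) :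
    insertCoord i t y (i.succAbove k) = y k := by
  simp [insertCoord]

@[simp] lemma dropCoord_insertCoord (t : ℝ) (y : E d) : dropCoord i (insertCoord i t y) = y := by
  ext k; simp

@[simp] lemma insertCoord_dropCoord (x : E (d + 1)) :
    insertCoord i (x i) (dropCoord i x) = x := by
  ext k
  refine Fin.succAboveCases i ?_ (fun j => ?_) k <;> simp

lemma insertCoord_eq_add (s t : ℝ) (y : E d) :
    insertCoord i t y = insertCoord i s y + (t - s) • EuclideanSpace.single i (1 : ℝ) := by
  ext k
  refine Fin.succAboveCases i ?_ (fun j => ?_) k <;> simp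

@[simp] lemma dropCoord_single (a : ℝ) : dropCoord i (EuclideanSpace.single i a) = 0 := by
  ext k; simp

lemma continuous_dropCoord : Continuous (dropCoord i) :=
  LinearMap.continuous_of_finiteDimensional _

lemma continuous_insertCoord : Continuous fun p : ℝ × E d => insertCoord i p.1 p.2 := by
  refine (PiLp.continuous_toLp 2 _).comp (continuous_pi fun k => ?_)
  refine Fin.succAboveCases i ?_ (fun j => ?_) k
  · simpa using continuous_fst
  · simp only [Fin.insertNth_apply_succAbove]
    fun_prop

lemma inner_dropCoord (x y : E (d + 1)) :
    ⟪dropCoord i x, dropCoord i y⟫ = ⟪x, y⟫ - x i * y i := by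
  simp only [PiLp.inner_apply, dropCoord_apply, Fin.sum_univ_succAbove _ i]
  simp [mul_comm]

/-- The projection along the `i`-th coordinate axis scales `d`-dimensional volume on the hyperplane
orthogonal to the unit vector `u` by `|u i|`. -/
lemma normDet_dropCoord_orthogonal {u : E (d + 1)} (hu : ‖u‖ = 1) :
    (dropCoord i ∘ₗ (ℝ ∙ u)ᗮ.subtype).normDet = |u i| := by
  set T := (ℝ ∙ u)ᗮ
  set e : E (d + 1) := EuclideanSpace.single i (1 : ℝ)
  have he : ∀ x : E (d + 1), ⟪e, x⟫ = x i := fun x => by simp [e, EuclideanSpace.inner_single_left]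
  set a : T := ⟨e - u i • u, by
    rw [Submodule.mem_orthogonal_singleton_iff_inner_right, inner_sub_right, inner_smul_right,
      real_inner_self_eq_norm_sq, hu, real_inner_comm, he]; simp⟩
  have ha : ∀ v : T, ⟪a, v⟫ = (v : E (d + 1)) i := by
    intro v
    have hv : ⟪u, (v : E (d + 1))⟫ = 0 :=
      Submodule.mem_orthogonal_singleton_iff_inner_right.1 v.2
    rw [Submodule.coe_inner]
    simp only [a]
    rw [inner_sub_left, inner_smul_left, hv, he]; simp
  set g := dropCoord i ∘ₗ T.subtype
  have hg : g.adjoint ∘ₗ g = LinearMap.transvection (innerₗ T a) (-a) := by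
    ext1 v
    refine ext_inner_right ℝ fun w => ?_
    rw [LinearMap.comp_apply, LinearMap.adjoint_inner_left]
    simp only [g, LinearMap.comp_apply, Submodule.subtype_apply, inner_dropCoord,
      LinearMap.transvection.apply, innerₗ_apply_apply, inner_add_left, inner_smul_left, ha,
      Submodule.coe_inner, smul_neg, inner_neg_left]
    simp
    ring
  have h := g.normDet_sq
  rw [hg, LinearMap.transvection.det, innerₗ_apply_apply, ha] at h
  have h2 : g.normDet ^ 2 = u i ^ 2 := by
    have : (1 : ℝ) + ((-a : T) : E (d + 1)) i = u i ^ 2 := by simp [a, e]; ring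
    rw [← this]; exact_mod_cast h
  rw [← abs_of_nonneg g.normDet_nonneg]
  exact (sq_eq_sq_iff_abs_eq_abs _ _).1 h2

end Coordinates

lemma hausdorffMeasure_le_of_dist_le {X Y : Type*} [MetricSpace X] [MeasurableSpace X]
    [BorelSpace X] [MetricSpace Y] [MeasurableSpace Y] [BorelSpace Y] {f : X → Y} {A : Set X}
    {C : ℝ≥0} {r : ℝ} (hr : 0 ≤ r) (h : ∀ x ∈ A, ∀ y ∈ A, dist x y ≤ C * dist (f x) (f y)) :
    μH[r] A ≤ (C : ℝ≥0∞) ^ r * μH[r] (f '' A) := by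
  have hinj : InjOn f A := fun x hx y hy hxy => by
    simpa [hxy] using h x hx y hy
  rcases A.eq_empty_or_nonempty with rfl | ⟨x₀, hx₀⟩
  · simp
  have : Nonempty X := ⟨x₀⟩
  have hL : LipschitzOnWith C (Function.invFunOn f A) (f '' A) := by
    refine LipschitzOnWith.of_dist_le_mul ?_
    rintro _ ⟨x, hx, rfl⟩ _ ⟨y, hy, rfl⟩
    rw [hinj.leftInvOn_invFunOn hx, hinj.leftInvOn_invFunOn hy]
    exact h x hx y hy
  have := hL.hausdorffMeasure_image_le hr
  rwa [hinj.invFunOn_image subset_rfl] at this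

lemma measure_restrict_le_of_locally_le {X : Type*} [TopologicalSpace X]
    [SecondCountableTopology X] [MeasurableSpace X] [OpensMeasurableSpace X] {m₁ m₂ : Measure X}
    {S : Set X} (hS : MeasurableSet S)
    (h : ∀ x ∈ S, ∃ N ∈ 𝓝 x, ∀ A ⊆ N ∩ S, MeasurableSet A → m₁ A ≤ m₂ A) :
    m₁.restrict S ≤ m₂.restrict S := by
  rcases S.eq_empty_or_nonempty with rfl | hne
  · simp
  choose! N hN hle using h
  obtain ⟨t, htS, htc, hcov⟩ := TopologicalSpace.countable_cover_nhdsWithin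
    (f := fun x => interior (N x)) (s := S)
    fun x hx => mem_nhdsWithin_of_mem_nhds (interior_mem_nhds.2 (hN x hx))
  have htne : t.Nonempty := by
    by_contra hcon
    rw [not_nonempty_iff_eq_empty.1 hcon] at hcov
    simp at hcov
    exact hne.ne_empty hcov
  obtain ⟨u, rfl⟩ := htc.exists_eq_range htne
  refine Measure.le_iff.2 fun A hA => ?_
  rw [Measure.restrict_apply hA, Measure.restrict_apply hA]
  set D := disjointed fun k => interior (N (u k))
  have hDm : ∀ k, MeasurableSet (D k) :=
    MeasurableSet.disjointed fun k => isOpen_interior.measurableSet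
  have hD : A ∩ S = ⋃ k, A ∩ S ∩ D k := by
    rw [← inter_iUnion, iUnion_disjointed]
    exact (inter_eq_left.2 (inter_subset_right.trans (hcov.trans (by rw [biUnion_range])))).symm
  have hdisj : Pairwise (Function.onFun Disjoint fun k => A ∩ S ∩ D k) := fun k l hkl =>
    (disjoint_disjointed _ hkl).mono inter_subset_right inter_subset_right
  have hm : ∀ k, MeasurableSet (A ∩ S ∩ D k) := fun k => (hA.inter hS).inter (hDm k)
  rw [hD, measure_iUnion hdisj hm, measure_iUnion hdisj hm]
  refine ENNReal.tsum_le_tsum fun k => hle (u k) (htS ⟨k, rfl⟩) _ ?_ (hm k)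
  exact fun x hx => ⟨interior_subset (disjointed_subset (fun k => interior (N (u k))) k hx.2), hx.1.2⟩

section Projection

variable {d : ℕ} (i : Fin (d + 1)) {M : Set (E (d + 1))} {ν : E (d + 1) → E (d + 1)}

/-- Near a point, a set with a continuous field of outer normals is almost contained in
its tangent hyperplane. -/
lemma exists_nhds_abs_inner_sub_le (hcont : ContinuousOn ν M)
    (houter : ∀ x ∈ M, ∀ y ∈ M, ⟪y - x, ν x⟫ ≤ 0) {x₀ : E (d + 1)} (hx₀ : x₀ ∈ M)
    {δ : ℝ} (hδ : 0 < δ) :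
    ∃ N ∈ 𝓝 x₀, ∀ x ∈ N ∩ M, ∀ y ∈ N ∩ M, |⟪y - x, ν x₀⟫| ≤ δ * ‖y - x‖ := by
  have h1 := mem_nhdsWithin_iff_exists_mem_nhds_inter.1
    ((hcont x₀ hx₀).preimage_mem_nhdsWithin (ball_mem_nhds (ν x₀) hδ))
  obtain ⟨N, hN, hsub⟩ := h1
  have key : ∀ x ∈ N ∩ M, ∀ y ∈ N ∩ M, ⟪y - x, ν x₀⟫ ≤ δ * ‖y - x‖ := fun x hx y hy => by
    have h2 : ‖ν x - ν x₀‖ ≤ δ := by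
      have := hsub hx
      rw [mem_preimage, mem_ball, dist_eq_norm] at this
      exact this.le
    calc ⟪y - x, ν x₀⟫ = ⟪y - x, ν x⟫ + ⟪y - x, ν x₀ - ν x⟫ := by
          rw [← inner_add_right]; congr 1; abel
      _ ≤ 0 + ‖y - x‖ * ‖ν x₀ - ν x‖ :=
          add_le_add (houter x hx.2 y hy.2) (real_inner_le_norm _ _)
      _ ≤ δ * ‖y - x‖ := by
          rw [norm_sub_rev (ν x₀), zero_add, mul_comm]; gcongr
  refine ⟨N, hN, fun x hx y hy => abs_le.2 ⟨?_, key x hx y hy⟩⟩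
  have := key y hy x hx
  rw [← neg_sub y x, inner_neg_left, norm_neg] at this
  linarith

lemma exists_pos_one_add_pow_le (d : ℕ) {c : ℝ≥0} (hc : 1 < c) :
    ∃ η : ℝ, 0 < η ∧ η < 1 ∧ (1 + η) ^ d ≤ c ∧ ((1 - η)⁻¹) ^ d ≤ c := by
  have hc' : (1 : ℝ) < c := by exact_mod_cast hc
  have h1 : Tendsto (fun η : ℝ => (1 + η) ^ d) (𝓝[>] 0) (𝓝 1) := by
    have : ContinuousAt (fun η : ℝ => (1 + η) ^ d) 0 := by fun_prop
    simpa [ContinuousAt] using this.tendsto.mono_left nhdsWithin_le_nhds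
  have h2 : Tendsto (fun η : ℝ => ((1 - η)⁻¹) ^ d) (𝓝[>] 0) (𝓝 1) := by
    have : ContinuousAt (fun η : ℝ => ((1 - η)⁻¹) ^ d) 0 := by
      refine ContinuousAt.pow (ContinuousAt.inv₀ (by fun_prop) (by simp)) _
    simpa [ContinuousAt] using this.tendsto.mono_left nhdsWithin_le_nhds
  have h3 : ∀ᶠ η : ℝ in 𝓝[>] 0, η < 1 :=
    (eventually_lt_nhds zero_lt_one).filter_mono nhdsWithin_le_nhds
  obtain ⟨η, h⟩ := (((h1.eventually_lt_const hc').and (h2.eventually_lt_const hc')).and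
    (h3.and self_mem_nhdsWithin)).exists
  exact ⟨η, h.2.2, h.2.1, h.1.1.le, h.1.2.le⟩

/-- Near a point `x₀` with `ν x₀ i ≠ 0`, the `i`-th coordinate projection scales the Hausdorff
measure by approximately `|ν x₀ i|`. -/
lemma exists_nhds_hausdorffMeasure_dropCoord (hcont : ContinuousOn ν M)
    (hunit : ∀ x ∈ M, ‖ν x‖ = 1)
    (houter : ∀ x ∈ M, ∀ y ∈ M, ⟪y - x, ν x⟫ ≤ 0) {x₀ : E (d + 1)} (hx₀ : x₀ ∈ M)
    (hi : ν x₀ i ≠ 0) {c : ℝ≥0} (hc : 1 < c) :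
    ∃ N ∈ 𝓝 x₀, ∀ A ⊆ N ∩ M,
      μH[d] (dropCoord i '' A) ≤ c * (‖ν x₀ i‖ₑ * μH[d] A) ∧
      ‖ν x₀ i‖ₑ * μH[d] A ≤ c * μH[d] (dropCoord i '' A) := by
  set u := ν x₀
  have hu : ‖u‖ = 1 := hunit x₀ hx₀
  obtain ⟨η, hη0, hη1, hηc, hηc'⟩ := exists_pos_one_add_pow_le d hc
  have hδ : 0 < η * |u i| := mul_pos hη0 (abs_pos.2 hi)
  obtain ⟨N, hN, hNM⟩ := exists_nhds_abs_inner_sub_le hcont houter hx₀ hδ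
  refine ⟨N, hN, fun A hA => ?_⟩
  set T := (ℝ ∙ u)ᗮ
  set e : E (d + 1) := EuclideanSpace.single i (1 : ℝ)
  have he : ‖e‖ = 1 := by simp [e]
  have hue : ⟪u, e⟫ = u i := by simp [e, EuclideanSpace.inner_single_right]
  let L₀ : E (d + 1) →ₗ[ℝ] E (d + 1) :=
    LinearMap.id - ((u i)⁻¹ • innerₗ (E (d + 1)) u).smulRight e
  have hL₀ : ∀ x, L₀ x = x - ((u i)⁻¹ * ⟪u, x⟫) • e := fun x => by simp [L₀]
  let L : E (d + 1) →ₗ[ℝ] T := L₀.codRestrict T fun x => by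
    rw [Submodule.mem_orthogonal_singleton_iff_inner_right, hL₀, inner_sub_right,
      inner_smul_right, hue]
    field_simp; ring
  have hLd : ∀ x y : E (d + 1), dist (L x) (L y) = ‖(y - x) - ((u i)⁻¹ * ⟪u, y - x⟫) • e‖ := by
    intro x y
    rw [dist_comm, dist_eq_norm, ← map_sub, ← hL₀]; rfl
  have hclose : ∀ x ∈ A, ∀ y ∈ A, ‖((u i)⁻¹ * ⟪u, y - x⟫) • e‖ ≤ η * dist x y := by
    intro x hx y hy
    have h1 := hNM x (hA hx) y (hA hy)
    rw [norm_smul, he, mul_one, norm_mul, norm_inv, Real.norm_eq_abs, Real.norm_eq_abs,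
      real_inner_comm, dist_comm, dist_eq_norm, inv_mul_le_iff₀ (abs_pos.2 hi)]
    linarith
  have hup : ∀ x ∈ A, ∀ y ∈ A, dist (L x) (L y) ≤ (1 + η) * dist x y := by
    intro x hx y hy
    have h1 := hclose x hx y hy
    have h2 := norm_sub_le (y - x) (((u i)⁻¹ * ⟪u, y - x⟫) • e)
    rw [hLd]
    rw [← dist_eq_norm y x, dist_comm y x] at h2
    linarith
  have hlow : ∀ x ∈ A, ∀ y ∈ A, dist x y ≤ (1 - η)⁻¹ * dist (L x) (L y) := by
    intro x hx y hy
    have h1 := hclose x hx y hy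
    have h2 := norm_sub_norm_le (y - x) (((u i)⁻¹ * ⟪u, y - x⟫) • e)
    rw [hLd, le_inv_mul_iff₀ (by linarith)]
    rw [← dist_eq_norm y x, dist_comm y x] at h2
    linarith
  have hd0 : (0 : ℝ) ≤ d := Nat.cast_nonneg d
  have hfin : Module.finrank ℝ T = d := by
    have : Fact (Module.finrank ℝ (E (d + 1)) = d + 1) := ⟨by simp⟩
    exact Submodule.finrank_orthogonal_span_singleton (by rintro h; simp [h] at hu)
  have hproj : μH[d] (dropCoord i '' A) = ‖u i‖ₑ * μH[d] (L '' A) := by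
    have h1 := (dropCoord i ∘ₗ T.subtype).hausdorffMeasure_image (L '' A)
    rw [normDet_dropCoord_orthogonal i hu, hfin, ← Real.enorm_eq_ofReal_abs] at h1
    rw [← h1, image_image]
    congr 1
    refine image_congr fun x _ => ?_
    change _ = dropCoord i (L₀ x)
    rw [hL₀, map_sub, map_smul, dropCoord_single]; simp
  have hpow : ∀ r : ℝ, 0 ≤ r → r ^ d ≤ c → (r.toNNReal : ℝ≥0∞) ^ (d : ℝ) ≤ c := by
    intro r hr hrc
    rw [ENNReal.rpow_natCast]
    rw [← ENNReal.coe_pow, ENNReal.coe_le_coe, ← NNReal.coe_le_coe]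
    simpa [hr] using hrc
  have hη1' : (0 : ℝ) ≤ (1 - η)⁻¹ := inv_nonneg.2 (by linarith)
  have hHup : μH[d] (L '' A) ≤ c * μH[d] A := by
    have hL : LipschitzOnWith (1 + η).toNNReal L A := by
      refine LipschitzOnWith.of_dist_le_mul fun x hx y hy => ?_
      rw [Real.coe_toNNReal _ (by linarith)]
      exact hup x hx y hy
    exact (hL.hausdorffMeasure_image_le hd0).trans
      (mul_le_mul_left (hpow _ (by linarith) hηc) _)
  have hHlow : μH[d] A ≤ c * μH[d] (L '' A) := by
    have h1 := hausdorffMeasure_le_of_dist_le (C := ((1 - η)⁻¹).toNNReal) (f := L) (A := A) hd0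
      (by rw [Real.coe_toNNReal _ hη1']; exact hlow)
    exact h1.trans (mul_le_mul_left (hpow _ hη1' hηc') _)
  rw [hproj]
  constructor
  · calc ‖u i‖ₑ * μH[d] (L '' A) ≤ ‖u i‖ₑ * (c * μH[d] A) := by gcongr
      _ = _ := by ring
  · calc ‖u i‖ₑ * μH[d] A ≤ ‖u i‖ₑ * (c * μH[d] (L '' A)) := by gcongr
      _ = _ := by ring

end Projection

section Projection

variable {d : ℕ} (i : Fin (d + 1)) {M S : Set (E (d + 1))} {ν : E (d + 1) → E (d + 1)}

lemma hausdorffMeasure_lt_top_of_outer_normal (hM : IsCompact M) (hcont : ContinuousOn ν M)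
    (hunit : ∀ x ∈ M, ‖ν x‖ = 1) (houter : ∀ x ∈ M, ∀ y ∈ M, ⟪y - x, ν x⟫ ≤ 0) :
    μH[d] M < ∞ := by
  refine hM.measure_lt_top_of_nhdsWithin fun x hx => ?_
  obtain ⟨i, hi⟩ : ∃ i, ν x i ≠ 0 := by
    by_contra! hcon
    have h0 : ν x = 0 := by ext k; exact hcon k
    simpa [h0] using hunit x hx
  obtain ⟨N, hN, h⟩ := exists_nhds_hausdorffMeasure_dropCoord i hcont hunit houter hx hi one_lt_two
  refine ⟨N ∩ M, inter_mem (mem_nhdsWithin_of_mem_nhds hN) self_mem_nhdsWithin, ?_⟩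
  have h1 : μH[d] (dropCoord i '' (N ∩ M)) < ∞ :=
    (measure_mono (image_mono inter_subset_right)).trans_lt
      (hM.image (continuous_dropCoord i)).measure_lt_top
  have h2 := ((h _ subset_rfl).2.trans_lt (ENNReal.mul_lt_top (by simp) h1))
  exact ENNReal.lt_top_of_mul_ne_top_right h2.ne (by simpa using hi)

lemma exists_nhds_enorm_le {f : E (d + 1) → ℝ} (hf : ContinuousOn f M) {x₀ : E (d + 1)}
    (hx₀ : x₀ ∈ M) (h0 : f x₀ ≠ 0) {c : ℝ≥0} (hc : 1 < c) :
    ∃ N ∈ 𝓝 x₀, ∀ x ∈ N ∩ M, ‖f x‖ₑ ≤ c * ‖f x₀‖ₑ ∧ ‖f x₀‖ₑ ≤ c * ‖f x‖ₑ := by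
  have hpos : 0 < ‖f x₀‖₊ := by simpa using h0
  have hlt : ‖f x₀‖₊ < c * ‖f x₀‖₊ := lt_mul_of_one_lt_left hpos hc
  have h1 : Tendsto (fun x => ‖f x‖₊) (𝓝[M] x₀) (𝓝 ‖f x₀‖₊) := (hf x₀ hx₀).nnnorm
  have h2 : ∀ᶠ x in 𝓝[M] x₀, ‖f x‖₊ < c * ‖f x₀‖₊ ∧ ‖f x₀‖₊ < c * ‖f x‖₊ :=
    (h1.eventually_lt_const hlt).and ((h1.const_mul c).eventually_const_lt hlt)
  obtain ⟨N, hN, hsub⟩ := mem_nhdsWithin_iff_exists_mem_nhds_inter.1 h2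
  refine ⟨N, hN, fun x hx => ?_⟩
  have := hsub hx
  simp only [enorm_eq_nnnorm]
  exact_mod_cast And.intro this.1.le this.2.le

lemma le_of_forall_one_lt_mul_mul {a b : ℝ≥0∞} (h : ∀ c : ℝ≥0, 1 < c → a ≤ c * (c * b)) :
    a ≤ b := by
  have h1 : Tendsto (fun c : ℝ≥0 => (c : ℝ≥0∞)) (𝓝[>] 1) (𝓝 1) :=
    (ENNReal.continuous_coe.tendsto 1).mono_left nhdsWithin_le_nhds
  have h2 : Tendsto (fun c : ℝ≥0 => (c : ℝ≥0∞) * b) (𝓝[>] 1) (𝓝 (1 * b)) :=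
    ENNReal.Tendsto.mul_const h1 (Or.inl one_ne_zero)
  have h3 : Tendsto (fun c : ℝ≥0 => (c : ℝ≥0∞) * (c * b)) (𝓝[>] 1) (𝓝 (1 * (1 * b))) :=
    ENNReal.Tendsto.mul h1 (Or.inl one_ne_zero) h2 (Or.inr ENNReal.one_ne_top)
  rw [one_mul, one_mul] at h3
  exact ge_of_tendsto h3 (eventually_mem_nhdsWithin.mono h)

/-- Change of variables for the `i`-th coordinate projection of a piece of hypersurface with
continuous outer unit normal `ν`. -/
lemma withDensity_hausdorffMeasure_eq (hcont : ContinuousOn ν M)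
    (hunit : ∀ x ∈ M, ‖ν x‖ = 1) (houter : ∀ x ∈ M, ∀ y ∈ M, ⟪y - x, ν x⟫ ≤ 0)
    (hS : MeasurableSet S) (hSM : S ⊆ M) (hi : ∀ x ∈ S, ν x i ≠ 0)
    (hinj : InjOn (dropCoord i) S) :
    (μH[d].restrict S).withDensity (fun x => ‖ν x i‖ₑ) =
      Measure.map ((↑) : S → E (d + 1)) (Measure.comap (S.domRestrict (dropCoord i)) μH[d]) := by
  have hemb : MeasurableEmbedding (S.domRestrict (dropCoord i)) :=
    (continuous_dropCoord i).continuousOn.measurableEmbedding hS hinj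
  set m₁ := (μH[d].restrict S).withDensity (fun x => ‖ν x i‖ₑ)
  set m₂ := Measure.map ((↑) : S → E (d + 1)) (Measure.comap (S.domRestrict (dropCoord i)) μH[d])
  have e₁ : ∀ A, MeasurableSet A → A ⊆ S → m₁ A = ∫⁻ x in A, ‖ν x i‖ₑ ∂μH[d] := by
    intro A hA hAS
    rw [withDensity_apply _ hA, Measure.restrict_restrict hA, inter_eq_left.2 hAS]
  have e₂ : ∀ A, MeasurableSet A → m₂ A = μH[d] (dropCoord i '' (A ∩ S)) := by
    intro A hA
    rw [Measure.map_apply measurable_subtype_coe hA, hemb.comap_apply]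
    congr 1
    ext y
    simp only [mem_image, Subtype.exists, mem_preimage, mem_inter_iff, domRestrict_apply]
    grind
  have hνi : ContinuousOn (fun x => ν x i) M := fun x hx =>
    ((EuclideanSpace.proj i).continuous.continuousAt).comp_continuousWithinAt (hcont x hx)
  have key : ∀ c : ℝ≥0, 1 < c → ∀ x ∈ S, ∃ N ∈ 𝓝 x, ∀ A ⊆ N ∩ S, MeasurableSet A →
      m₁ A ≤ c * (c * m₂ A) ∧ m₂ A ≤ c * (c * m₁ A) := by
    intro c hc x hx
    obtain ⟨N₁, hN₁, h₁⟩ := exists_nhds_hausdorffMeasure_dropCoord i hcont hunit houter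
      (hSM hx) (hi x hx) hc
    obtain ⟨N₂, hN₂, h₂⟩ := exists_nhds_enorm_le hνi (hSM hx) (hi x hx) hc
    refine ⟨N₁ ∩ N₂, inter_mem hN₁ hN₂, fun A hA hAm => ?_⟩
    have hAS : A ⊆ S := fun z hz => (hA hz).2
    obtain ⟨h3, h4⟩ := h₁ A fun z hz => ⟨(hA hz).1.1, hSM (hAS hz)⟩
    have h5 : ∀ z ∈ A, z ∈ N₂ ∩ M := fun z hz => ⟨(hA hz).1.2, hSM (hAS hz)⟩
    rw [e₁ A hAm hAS, e₂ A hAm, inter_eq_left.2 hAS]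
    constructor
    · calc ∫⁻ z in A, ‖ν z i‖ₑ ∂μH[d] ≤ ∫⁻ z in A, c * ‖ν x i‖ₑ ∂μH[d] :=
            setLIntegral_mono' hAm fun z hz => (h₂ z (h5 z hz)).1
        _ = c * (‖ν x i‖ₑ * μH[d] A) := by rw [setLIntegral_const]; ring
        _ ≤ _ := by gcongr
    · calc _ ≤ _ := h3
        _ = c * ∫⁻ z in A, ‖ν x i‖ₑ ∂μH[d] := by rw [setLIntegral_const]
        _ ≤ c * ∫⁻ z in A, c * ‖ν z i‖ₑ ∂μH[d] :=
            mul_le_mul_right (setLIntegral_mono' hAm fun z hz => (h₂ z (h5 z hz)).2) _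
        _ = _ := by rw [lintegral_const_mul' _ _ ENNReal.coe_ne_top]
  have hle : m₁.restrict S ≤ m₂.restrict S := by
    refine Measure.le_iff.2 fun A hA => le_of_forall_one_lt_mul_mul fun c hc => ?_
    have := measure_restrict_le_of_locally_le (m₁ := m₁) (m₂ := ((c : ℝ≥0∞) * c) • m₂) hS
      fun x hx => (key c hc x hx).imp fun N hN => ⟨hN.1, fun A h h' => by
        simpa only [Measure.smul_apply, smul_eq_mul, mul_assoc] using (hN.2 A h h').1⟩
    simpa only [Measure.restrict_smul, Measure.smul_apply, smul_eq_mul, mul_assoc] using this A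
  have hge : m₂.restrict S ≤ m₁.restrict S := by
    refine Measure.le_iff.2 fun A hA => le_of_forall_one_lt_mul_mul fun c hc => ?_
    have := measure_restrict_le_of_locally_le (m₁ := m₂) (m₂ := ((c : ℝ≥0∞) * c) • m₁) hS
      fun x hx => (key c hc x hx).imp fun N hN => ⟨hN.1, fun A h h' => by
        simpa only [Measure.smul_apply, smul_eq_mul, mul_assoc] using (hN.2 A h h').2⟩
    simpa only [Measure.restrict_smul, Measure.smul_apply, smul_eq_mul, mul_assoc] using this A
  have r₁ : m₁.restrict S = m₁ := by
    rw [restrict_withDensity hS, Measure.restrict_restrict hS, inter_self]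
  have r₂ : m₂.restrict S = m₂ := by
    ext A hA
    rw [Measure.restrict_apply hA, e₂ _ (hA.inter hS), e₂ _ hA, inter_assoc, inter_self]
  rw [← r₁, ← r₂]
  exact le_antisymm hle hge

lemma aemeasurable_enorm_normal (hcont : ContinuousOn ν M) (hS : MeasurableSet S) (hSM : S ⊆ M) :
    AEMeasurable (fun x => ‖ν x i‖ₑ) (μH[d].restrict S) := by
  have hνi : ContinuousOn (fun x => ν x i) S := fun x hx =>
    ((EuclideanSpace.proj i).continuous.continuousAt).comp_continuousWithinAt
      ((hcont x (hSM hx)).mono hSM)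
  exact (hνi.aemeasurable hS).enorm

lemma integral_abs_normal_mul (hcont : ContinuousOn ν M)
    (hunit : ∀ x ∈ M, ‖ν x‖ = 1) (houter : ∀ x ∈ M, ∀ y ∈ M, ⟪y - x, ν x⟫ ≤ 0)
    (hS : MeasurableSet S) (hSM : S ⊆ M) (hi : ∀ x ∈ S, ν x i ≠ 0)
    (hinj : InjOn (dropCoord i) S) (G : E d → ℝ) :
    (IntegrableOn G (dropCoord i '' S) μH[d] ↔
      IntegrableOn (fun x => |ν x i| * G (dropCoord i x)) S μH[d]) ∧
    ∫ y in dropCoord i '' S, G y ∂μH[d] =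
      ∫ x in S, |ν x i| * G (dropCoord i x) ∂μH[d] := by
  have hemb : MeasurableEmbedding (S.domRestrict (dropCoord i)) :=
    (continuous_dropCoord i).continuousOn.measurableEmbedding hS hinj
  have hcoe := MeasurableEmbedding.subtype_coe hS
  have hmeas := withDensity_hausdorffMeasure_eq i hcont hunit houter hS hSM hi hinj
  have hae := aemeasurable_enorm_normal i hcont hS hSM
  have hres : (μH[d] : Measure (E d)).restrict (dropCoord i '' S) =
      Measure.map (S.domRestrict (dropCoord i))
        (Measure.comap (S.domRestrict (dropCoord i)) μH[d]) := by
    rw [hemb.map_comap, range_domRestrict]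
  have hlt : ∀ᵐ x ∂(μH[d].restrict S), ‖ν x i‖ₑ < ∞ := by simp
  constructor
  · rw [IntegrableOn, hres, hemb.integrable_map_iff, IntegrableOn]
    have h1 := integrable_withDensity_iff_integrable_smul₀' hae hlt
      (g := fun x => G (dropCoord i x))
    simp only [toReal_enorm, Real.norm_eq_abs, smul_eq_mul] at h1
    rw [← h1, hmeas, hcoe.integrable_map_iff]
    rfl
  · rw [hres, hemb.integral_map]
    have h1 := integral_withDensity_eq_integral_toReal_smul₀ hae hlt
      (fun x => G (dropCoord i x))
    simp only [toReal_enorm, Real.norm_eq_abs, smul_eq_mul] at h1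
    rw [← h1, hmeas, hcoe.integral_map]
    rfl

end Projection

section Fubini

variable {d : ℕ} (i : Fin (d + 1))

/-- `insertCoord i` as a measurable equivalence. -/
def insertCoordEquiv : ℝ × E d ≃ᵐ E (d + 1) :=
  ((MeasurableEquiv.refl ℝ).prodCongr (MeasurableEquiv.toLp 2 (Fin d → ℝ)).symm).trans
    ((MeasurableEquiv.piFinSuccAbove (fun _ => ℝ) i).symm.trans
      (MeasurableEquiv.toLp 2 (Fin (d + 1) → ℝ)))

lemma insertCoordEquiv_apply (p : ℝ × E d) : insertCoordEquiv i p = insertCoord i p.1 p.2 := rfl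

lemma measurePreserving_insertCoordEquiv :
    MeasurePreserving (insertCoordEquiv i) (volume : Measure (ℝ × E d)) volume :=
  (PiLp.volume_preserving_toLp (Fin (d + 1))).comp
    (((volume_preserving_piFinSuccAbove (fun _ => ℝ) i).symm _).comp
      ((MeasurePreserving.id volume).prod (PiLp.volume_preserving_ofLp (Fin d))))

lemma setIntegral_eq_integral_insertCoord {K : Set (E (d + 1))} (hK : IsCompact K)
    {g : E (d + 1) → ℝ} (hg : Continuous g) :
    ∫ x in K, g x = ∫ y : E d, ∫ t in {t | insertCoord i t y ∈ K}, g (insertCoord i t y) := by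
  have hmp := measurePreserving_insertCoordEquiv (d := d) i
  have hint : Integrable (K.indicator g) :=
    (integrable_indicator_iff hK.measurableSet).2 (hg.continuousOn.integrableOn_compact hK)
  have hint' : Integrable (fun p : ℝ × E d => K.indicator g (insertCoord i p.1 p.2))
      (volume.prod volume) :=
    (hmp.integrable_comp_emb (insertCoordEquiv i).measurableEmbedding).2 hint
  rw [← integral_indicator hK.measurableSet,
    ← hmp.integral_comp (insertCoordEquiv i).measurableEmbedding]
  simp only [insertCoordEquiv_apply]
  rw [Measure.volume_eq_prod, integral_prod_symm _ hint']
  refine integral_congr_ae (Eventually.of_forall fun y => ?_)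
  have hm : MeasurableSet {t | insertCoord i t y ∈ K} :=
    hK.measurableSet.preimage ((continuous_insertCoord i).comp (.prodMk_left y)).measurable
  simp only
  rw [← integral_indicator hm]
  rfl

end Fubini

section Convex

variable {d : ℕ} (i : Fin (d + 1)) {K : Set (E (d + 1))} {ν : E (d + 1) → E (d + 1)}

lemma inner_normal_neg_of_mem_interior (hunit : ∀ x ∈ frontier K, ‖ν x‖ = 1)
    (houter : ∀ x ∈ frontier K, ∀ y ∈ K, ⟪y - x, ν x⟫ ≤ 0) {x z : E (d + 1)}
    (hx : x ∈ frontier K) (hz : z ∈ interior K) : ⟪z - x, ν x⟫ < 0 := by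
  obtain ⟨r, hr, hball⟩ := Metric.isOpen_iff.1 isOpen_interior z hz
  have hmem : z + (r / 2) • ν x ∈ K := interior_subset <| hball <| by
    rw [mem_ball, dist_eq_norm, add_sub_cancel_left, norm_smul, hunit x hx, mul_one,
      Real.norm_eq_abs, abs_of_pos (by linarith)]
    linarith
  have h := houter x hx _ hmem
  rw [add_sub_right_comm, inner_add_left, real_inner_smul_left, real_inner_self_eq_norm_sq,
    hunit x hx] at h
  linarith

lemma inner_insertCoord_sub (u : E (d + 1)) (s t : ℝ) (y : E d) :
    ⟪insertCoord i t y - insertCoord i s y, u⟫ = (t - s) * u i := by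
  rw [insertCoord_eq_add i s t y, add_sub_cancel_left, real_inner_smul_left,
    EuclideanSpace.inner_single_left]
  simp

lemma sub_mul_normal_nonpos (houter : ∀ x ∈ frontier K, ∀ y ∈ K, ⟪y - x, ν x⟫ ≤ 0)
    {x : E (d + 1)} (hx : x ∈ frontier K) {t : ℝ} (ht : insertCoord i t (dropCoord i x) ∈ K) :
    (t - x i) * ν x i ≤ 0 := by
  rw [← inner_insertCoord_sub i (ν x) (x i) t (dropCoord i x), insertCoord_dropCoord]
  exact houter x hx _ ht

lemma isCompact_fiber (hK : IsCompact K) (y : E d) : IsCompact {t | insertCoord i t y ∈ K} := by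
  have h : {t | insertCoord i t y ∈ K} =
      (fun x : E (d + 1) => x i) '' (K ∩ dropCoord i ⁻¹' {y}) := by
    ext t
    constructor
    · intro ht
      exact ⟨insertCoord i t y, ⟨ht, by simp⟩, by simp⟩
    · rintro ⟨x, ⟨hx, rfl⟩, rfl⟩
      simpa using hx
  rw [h]
  exact (hK.inter_right (isClosed_singleton.preimage (continuous_dropCoord i))).image
    (EuclideanSpace.proj i).continuous

lemma notMem_interior_of_forall_le {t : ℝ} {y : E d} {σ : ℝ} (hσ : σ ≠ 0)
    (h : ∀ s, insertCoord i s y ∈ K → σ * s ≤ σ * t) : insertCoord i t y ∉ interior K := by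
  intro hmem
  have hc : ContinuousAt (fun r : ℝ => insertCoord i (t + r * σ) y) 0 :=
    ((continuous_insertCoord i).comp (by fun_prop : Continuous fun r : ℝ =>
      (t + r * σ, y))).continuousAt
  have h1 : ∀ᶠ r : ℝ in 𝓝[>] 0, insertCoord i (t + r * σ) y ∈ interior K :=
    (hc.eventually (isOpen_interior.mem_nhds (by simpa using hmem))).filter_mono
      nhdsWithin_le_nhds
  obtain ⟨r, hr, hr0⟩ := (h1.and self_mem_nhdsWithin).exists
  have := h _ (interior_subset hr)
  have h2 : 0 < r * (σ * σ) := mul_pos hr0 (mul_self_pos.2 hσ)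
  linarith

/-- An extreme point (in direction `σ`) of a fibre through the interior is a boundary point whose
normal has `i`-th coordinate of the sign of `σ`. -/
lemma extreme_fiber_point (hK : IsClosed K) (hunit : ∀ x ∈ frontier K, ‖ν x‖ = 1)
    (houter : ∀ x ∈ frontier K, ∀ y ∈ K, ⟪y - x, ν x⟫ ≤ 0) {y : E d}
    (hy : y ∈ dropCoord i '' interior K) {t σ : ℝ} (hσ : σ ≠ 0) (ht : insertCoord i t y ∈ K)
    (h : ∀ s, insertCoord i s y ∈ K → σ * s ≤ σ * t) :
    insertCoord i t y ∈ frontier K ∧ 0 < σ * ν (insertCoord i t y) i := by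
  have hfr : insertCoord i t y ∈ frontier K := by
    rw [hK.frontier_eq]
    exact ⟨ht, notMem_interior_of_forall_le i hσ h⟩
  refine ⟨hfr, ?_⟩
  obtain ⟨z, hz, rfl⟩ := hy
  have h1 := inner_normal_neg_of_mem_interior hunit houter hfr hz
  have h2 := inner_insertCoord_sub i (ν (insertCoord i t (dropCoord i z))) t (z i)
    (dropCoord i z)
  rw [insertCoord_dropCoord] at h2
  rw [h2] at h1
  have h3 := h (z i) (by simpa using interior_subset hz)
  have h4 : 0 ≤ σ * (t - z i) := by linarith
  by_contra! hcon
  have h5 : 0 ≤ (z i - t) * ν (insertCoord i t (dropCoord i z)) i * (σ * σ) := by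
    nlinarith [mul_nonneg h4 (neg_nonneg.2 hcon)]
  nlinarith [mul_self_pos.2 hσ]

lemma dropCoord_image_ae_eq (hKconv : Convex ℝ K) (hKint : (interior K).Nonempty)
    {S : Set (E (d + 1))} (hSK : S ⊆ closure K)
    (hS : dropCoord i '' interior K ⊆ dropCoord i '' S) :
    (dropCoord i '' S : Set (E d)) =ᵐ[μH[d]] (dropCoord i '' interior K : Set (E d)) := by
  set Ω : Set (E d) := dropCoord i '' interior K
  have hopen : IsOpen Ω := by
    have hsurj : Function.Surjective (dropCoord i) := fun y => ⟨insertCoord i 0 y, by simp⟩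
    exact LinearMap.isOpenMap_of_finiteDimensional _ hsurj _ isOpen_interior
  have hconv : Convex ℝ Ω := hKconv.interior.linear_image _
  have hnull : μH[d] (frontier Ω) = 0 := hconv.addHaar_frontier _
  have hsub : dropCoord i '' S ⊆ closure Ω := by
    refine (image_mono hSK).trans ?_
    rw [← hKconv.closure_interior_eq_closure_of_nonempty_interior hKint]
    exact image_closure_subset_closure_image (continuous_dropCoord i)
  refine (ae_le_set.2 (measure_mono_null ?_ hnull)).antisymm (LE.le.eventuallyLE hS)
  rw [hopen.frontier_eq]
  exact Set.sdiff_subset_sdiff_left hsub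

end Convex

section GaussGreen

variable {d : ℕ} (i : Fin (d + 1)) {K : Set (E (d + 1))} {ν : E (d + 1) → E (d + 1)}

lemma hausdorffMeasure_frontier_lt_top (hK : IsCompact K) (hcont : ContinuousOn ν (frontier K))
    (hunit : ∀ x ∈ frontier K, ‖ν x‖ = 1)
    (houter : ∀ x ∈ frontier K, ∀ y ∈ K, ⟪y - x, ν x⟫ ≤ 0) : μH[d] (frontier K) < ∞ :=
  hausdorffMeasure_lt_top_of_outer_normal
    (hK.of_isClosed_subset isClosed_frontier hK.isClosed.frontier_subset) hcont hunit
    fun x hx y hy => houter x hx y (hK.isClosed.frontier_subset hy)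

lemma integrableOn_frontier (hK : IsCompact K) (hcont : ContinuousOn ν (frontier K))
    (hunit : ∀ x ∈ frontier K, ‖ν x‖ = 1)
    (houter : ∀ x ∈ frontier K, ∀ y ∈ K, ⟪y - x, ν x⟫ ≤ 0)
    {f : E (d + 1) → ℝ} (hf : ContinuousOn f (frontier K)) :
    IntegrableOn f (frontier K) μH[d] :=
  hf.integrableOn_of_subset_isCompact
    (hK.of_isClosed_subset isClosed_frontier hK.isClosed.frontier_subset)
    isClosed_frontier.measurableSet Subset.rfl
    (hausdorffMeasure_frontier_lt_top hK hcont hunit houter).ne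

/-- The part of the boundary whose normal has `i`-th coordinate of the sign of `σ` is, up to a null
set, the graph over the projection of `K` of the extreme points of the fibres. -/
lemma setIntegral_signed_part (hKconv : Convex ℝ K) (hK : IsCompact K)
    (hKint : (interior K).Nonempty) (hcont : ContinuousOn ν (frontier K))
    (hunit : ∀ x ∈ frontier K, ‖ν x‖ = 1)
    (houter : ∀ x ∈ frontier K, ∀ y ∈ K, ⟪y - x, ν x⟫ ≤ 0)
    {f : E (d + 1) → ℝ} (hf : ContinuousOn f (frontier K)) {σ : ℝ} (hσ : σ ≠ 0) {τ : E d → ℝ}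
    (hτ : ∀ y ∈ dropCoord i '' K, insertCoord i (τ y) y ∈ K)
    (hτ' : ∀ y ∈ dropCoord i '' K, ∀ s, insertCoord i s y ∈ K → σ * s ≤ σ * τ y) :
    MeasurableSet {x ∈ frontier K | 0 < σ * ν x i} ∧
    IntegrableOn (fun y => f (insertCoord i (τ y) y)) (dropCoord i '' interior K) μH[d] ∧
    ∫ y in dropCoord i '' interior K, f (insertCoord i (τ y) y) ∂μH[d] =
      ∫ x in {x ∈ frontier K | 0 < σ * ν x i}, |ν x i| * f x ∂μH[d] := by
  set S := {x ∈ frontier K | 0 < σ * ν x i} with hSdef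
  have hνi : ContinuousOn (fun x => ν x i) (frontier K) :=
    (EuclideanSpace.proj i).continuous.comp_continuousOn hcont
  have hS : MeasurableSet S := by
    obtain ⟨u, hu, hu'⟩ := continuousOn_iff'.1 (continuousOn_const.mul hνi : ContinuousOn
      (fun x => σ * ν x i) (frontier K)) _ isOpen_Ioi
    have : S = u ∩ frontier K := by
      rw [← hu']
      ext x
      exact and_comm
    rw [this]
    exact hu.measurableSet.inter isClosed_frontier.measurableSet
  have hSM : S ⊆ frontier K := fun x hx => hx.1
  have hMK := hK.isClosed.frontier_subset
  have htop : ∀ x ∈ S, τ (dropCoord i x) = x i := by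
    intro x hx
    have hxy : dropCoord i x ∈ dropCoord i '' K := ⟨x, hMK hx.1, rfl⟩
    have h1 := sub_mul_normal_nonpos i houter hx.1 (hτ _ hxy)
    have h2 := hτ' _ hxy (x i) (by simpa using hMK hx.1)
    have h3 : σ * (τ (dropCoord i x) - x i) ≤ 0 := by
      by_contra! hcon
      nlinarith [mul_pos hcon hx.2, mul_nonneg (mul_self_nonneg σ) (sub_nonneg.2 h1)]
    have h4 : σ * (τ (dropCoord i x) - x i) = 0 := le_antisymm h3 (by linarith)
    linarith [(mul_eq_zero.1 h4).resolve_left hσ]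
  have hpt : ∀ x ∈ S, insertCoord i (τ (dropCoord i x)) (dropCoord i x) = x := fun x hx => by
    rw [htop x hx, insertCoord_dropCoord]
  have hinj : InjOn (dropCoord i) S := fun x hx y hy hxy => by
    rw [← hpt x hx, hxy, hpt y hy]
  have himg : dropCoord i '' interior K ⊆ dropCoord i '' S := by
    intro y hy
    have hyK : y ∈ dropCoord i '' K := image_mono interior_subset hy
    exact ⟨_, extreme_fiber_point i hK.isClosed hunit houter hy hσ (hτ y hyK) (hτ' y hyK),
      by simp⟩
  have hae := dropCoord_image_ae_eq i hKconv hKint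
    (hSM.trans frontier_subset_closure) himg
  obtain ⟨h1, h2⟩ := integral_abs_normal_mul i hcont hunit
    (fun x hx y hy => houter x hx y (hMK hy)) hS hSM
    (fun x hx h0 => by simp [hSdef, h0] at hx) hinj (fun y => f (insertCoord i (τ y) y))
  have hcongr : EqOn (fun x => |ν x i| * f (insertCoord i (τ (dropCoord i x)) (dropCoord i x)))
      (fun x => |ν x i| * f x) S := fun x hx => by simp only [hpt x hx]
  have hint : IntegrableOn (fun x => |ν x i| * f x) S μH[d] :=
    (integrableOn_frontier hK hcont hunit houter (hνi.abs.mul hf)).mono_set hSM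
  refine ⟨hS, ?_, ?_⟩
  · exact (integrableOn_congr_set_ae hae).1 (h1.2 (hint.congr_fun hcongr.symm hS))
  · rw [← setIntegral_congr_set hae, h2]
    exact setIntegral_congr_fun hS hcongr

lemma hasDerivAt_insertCoord (y : E d) (t : ℝ) :
    HasDerivAt (fun t => insertCoord i t y) (EuclideanSpace.single i (1 : ℝ)) t := by
  have h : (fun t => insertCoord i t y) =
      fun t => insertCoord i 0 y + t • EuclideanSpace.single i (1 : ℝ) := by
    funext t
    rw [insertCoord_eq_add i 0 t y, sub_zero]
  rw [h]
  simpa using ((hasDerivAt_id t).smul_const (EuclideanSpace.single i (1 : ℝ))).const_add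
    (insertCoord i 0 y)

lemma integral_fiber_fderiv (hKconv : Convex ℝ K) (hK : IsCompact K) {f : E (d + 1) → ℝ}
    (hf : ContDiff ℝ 1 f) {y : E d} (hy : y ∈ dropCoord i '' K) :
    ∫ t in {t | insertCoord i t y ∈ K},
      fderiv ℝ f (insertCoord i t y) (EuclideanSpace.single i (1 : ℝ)) =
      f (insertCoord i (sSup {t | insertCoord i t y ∈ K}) y) -
        f (insertCoord i (sInf {t | insertCoord i t y ∈ K}) y) := by
  set F := {t | insertCoord i t y ∈ K}
  have hF : IsCompact F := isCompact_fiber i hK y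
  have hne : F.Nonempty := by
    obtain ⟨x, hx, rfl⟩ := hy
    exact ⟨x i, by simpa [F] using hx⟩
  have hconv : Convex ℝ F := by
    intro s hs t ht a b ha hb hab
    have := hKconv hs ht ha hb hab
    suffices h : insertCoord i (a • s + b • t) y =
        a • insertCoord i s y + b • insertCoord i t y from mem_ofPred.2 (h ▸ this)
    rw [insertCoord_eq_add i 0 (a • s + b • t) y, insertCoord_eq_add i 0 s y,
      insertCoord_eq_add i 0 t y]
    simp only [smul_add, sub_zero, smul_smul, smul_eq_mul]
    rw [add_add_add_comm, ← add_smul, hab, one_smul, ← add_smul]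
  have hIcc : F = Icc (sInf F) (sSup F) := by
    refine (subset_Icc_csInf_csSup hF.bddBelow hF.bddAbove).antisymm ?_
    exact hconv.ordConnected.out (hF.sInf_mem hne) (hF.sSup_mem hne)
  have hle : sInf F ≤ sSup F := csInf_le_csSup hne hF.bddBelow hF.bddAbove
  have hcd : Continuous fun t => fderiv ℝ f (insertCoord i t y)
      (EuclideanSpace.single i (1 : ℝ)) :=
    ((hf.continuous_fderiv one_ne_zero).comp
      ((continuous_insertCoord i).comp (.prodMk_left y))).clm_apply continuous_const
  have hFTC := intervalIntegral.integral_eq_sub_of_hasDerivAt (a := sInf F) (b := sSup F)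
    (fun t _ => (hf.differentiable one_ne_zero (insertCoord i t y)).hasFDerivAt.comp_hasDerivAt t
      (hasDerivAt_insertCoord i y t)) (hcd.intervalIntegrable _ _)
  rw [intervalIntegral.integral_of_le hle, ← integral_Icc_eq_integral_Ioc, ← hIcc] at hFTC
  exact hFTC

/-- Gauss-Green formula on a convex body with continuous outer normal, up to the normalisation
of the Hausdorff measure. -/
lemma exists_gauss_green (hKconv : Convex ℝ K) (hK : IsCompact K)
    (hKint : (interior K).Nonempty) (hcont : ContinuousOn ν (frontier K))
    (hunit : ∀ x ∈ frontier K, ‖ν x‖ = 1)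
    (houter : ∀ x ∈ frontier K, ∀ y ∈ K, ⟪y - x, ν x⟫ ≤ 0) :
    ∃ c : ℝ, ∀ (i : Fin (d + 1)) (f : E (d + 1) → ℝ), ContDiff ℝ 1 f →
      ∫ x in frontier K, ν x i * f x ∂μH[d] =
        c * ∫ x in K, fderiv ℝ f x (EuclideanSpace.single i (1 : ℝ)) := by
  have hHaar : (μH[d] : Measure (E d)).IsAddHaarMeasure := by
    simpa using (inferInstance : (μH[Module.finrank ℝ (E d)] : Measure (E d)).IsAddHaarMeasure)
  have hsmul := Measure.isAddLeftInvariant_eq_smul (μH[d] : Measure (E d)) volume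
  set κ := Measure.addHaarScalarFactor (μH[d] : Measure (E d)) volume
  have hκ : κ ≠ 0 := Measure.addHaarScalarFactor_pos_of_isAddHaarMeasure _ _ |>.ne'
  refine ⟨κ, fun i f hf => ?_⟩
  set Ω : Set (E d) := dropCoord i '' interior K
  set F : E d → Set ℝ := fun y => {t | insertCoord i t y ∈ K}
  have hF : ∀ y, IsCompact (F y) := fun y => isCompact_fiber i hK y
  have hne : ∀ y ∈ dropCoord i '' K, (F y).Nonempty := by
    rintro _ ⟨x, hx, rfl⟩
    exact ⟨x i, by simpa [F] using hx⟩
  obtain ⟨hSp, hip, hp⟩ := setIntegral_signed_part i hKconv hK hKint hcont hunit houter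
    hf.continuous.continuousOn one_ne_zero (τ := fun y => sSup (F y))
    (fun y hy => (hF y).sSup_mem (hne y hy))
    (fun y hy s hs => by simpa using le_csSup (hF y).bddAbove hs)
  obtain ⟨hSm, him, hm⟩ := setIntegral_signed_part i hKconv hK hKint hcont hunit houter
    hf.continuous.continuousOn (neg_ne_zero.2 one_ne_zero) (τ := fun y => sInf (F y))
    (fun y hy => (hF y).sInf_mem (hne y hy))
    (fun y hy s hs => by simpa using csInf_le (hF y).bddBelow hs)
  set Sp := {x ∈ frontier K | 0 < 1 * ν x i} with hSpdef
  set Sm := {x ∈ frontier K | 0 < -1 * ν x i} with hSmdef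
  have hνi : ContinuousOn (fun x => ν x i) (frontier K) :=
    (EuclideanSpace.proj i).continuous.comp_continuousOn hcont
  have hint : IntegrableOn (fun x => ν x i * f x) (frontier K) μH[d] :=
    integrableOn_frontier hK hcont hunit houter (hνi.mul hf.continuous.continuousOn)
  have hsub : Sp ∪ Sm ⊆ frontier K := union_subset (fun x hx => hx.1) (fun x hx => hx.1)
  have hsplit : ∫ x in frontier K, ν x i * f x ∂μH[d] =
      ∫ x in Sp, |ν x i| * f x ∂μH[d] - ∫ x in Sm, |ν x i| * f x ∂μH[d] := by
    rw [setIntegral_eq_of_subset_of_forall_sdiff_eq_zero isClosed_frontier.measurableSet hsub,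
      setIntegral_union _ hSm (hint.mono_set (subset_union_left.trans hsub))
        (hint.mono_set (subset_union_right.trans hsub)), sub_eq_add_neg, ← integral_neg]
    · congr 1
      · refine setIntegral_congr_fun hSp fun x hx => ?_
        have : 0 < ν x i := by simpa using hx.2
        simp only [abs_of_pos this]
      · refine setIntegral_congr_fun hSm fun x hx => ?_
        have : ν x i < 0 := by simpa using hx.2
        simp only [abs_of_neg this]
        ring
    · rw [Set.disjoint_left]
      rintro x ⟨_, hx⟩ ⟨_, hx'⟩
      linarith
    · rintro x ⟨hx, hx'⟩
      have : ν x i = 0 := by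
        rcases lt_trichotomy (ν x i) 0 with h | h | h
        · exact absurd (Or.inr ⟨hx, by linarith⟩) hx'
        · exact h
        · exact absurd (Or.inl ⟨hx, by linarith⟩) hx'
      rw [this, zero_mul]
  have hΩ : MeasurableSet Ω :=
    (LinearMap.isOpenMap_of_finiteDimensional (dropCoord i)
      (fun y => ⟨insertCoord i 0 y, by simp⟩) _ isOpen_interior).measurableSet
  have hKae : (dropCoord i '' K : Set (E d)) =ᵐ[volume] Ω := by
    have h := dropCoord_image_ae_eq i hKconv hKint (subset_closure (s := K))
      (image_mono interior_subset)
    rw [hsmul] at h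
    exact (Measure.absolutelyContinuous_smul (ENNReal.coe_ne_zero.2 hκ)).ae_eq h
  rw [hsplit, ← hp, ← hm, ← integral_sub hip him, hsmul, Measure.restrict_smul,
    integral_smul_nnreal_measure, NNReal.smul_def, smul_eq_mul,
    setIntegral_eq_integral_insertCoord i hK
      ((hf.continuous_fderiv one_ne_zero).clm_apply continuous_const)]
  congr 1
  have hcompl : ∀ y ∉ dropCoord i '' K, ∫ t in {t | insertCoord i t y ∈ K},
      fderiv ℝ f (insertCoord i t y) (EuclideanSpace.single i (1 : ℝ)) = 0 := by
    intro y hy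
    have : {t | insertCoord i t y ∈ K} = ∅ := by
      ext t
      simp only [mem_ofPred_eq, mem_empty_iff_false, iff_false]
      exact fun ht => hy ⟨_, ht, by simp⟩
    rw [this, Measure.restrict_empty, integral_zero_measure]
  rw [← setIntegral_eq_integral_of_forall_compl_eq_zero hcompl, setIntegral_congr_set hKae]
  exact setIntegral_congr_fun hΩ fun y hy =>
    (integral_fiber_fderiv i hKconv hK hf (image_mono interior_subset hy)).symm

end GaussGreen

section Mollification

open scoped Convolution ContDiff

variable {X : Type*} [NormedAddCommGroup X] [InnerProductSpace ℝ X] [FiniteDimensional ℝ X]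
  [MeasurableSpace X] [BorelSpace X]

/-- Uniform `C¹` approximation of compactly supported `C¹` functions by smooth functions. -/
lemma exists_contDiff_fderiv_sub_le {f : X → ℝ} (hf : ContDiff ℝ 1 f) (hc : HasCompactSupport f)
    {ε : ℝ} (hε : 0 < ε) :
    ∃ g : X → ℝ, ContDiff ℝ 2 g ∧ ∀ x, ‖fderiv ℝ g x - fderiv ℝ f x‖ ≤ ε := by
  have huc : UniformContinuous (fderiv ℝ f) :=
    (hc.fderiv ℝ).uniformContinuous_of_continuous (hf.continuous_fderiv one_ne_zero)
  obtain ⟨δ, hδ, hδ'⟩ := Metric.uniformContinuous_iff.1 huc ε hε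
  let φ : ContDiffBump (0 : X) := ⟨δ / 2, δ, by linarith, by linarith⟩
  have hφ : ContDiff ℝ ∞ (φ.normed (volume : Measure X)) := φ.contDiff_normed
  refine ⟨φ.normed volume ⋆[ContinuousLinearMap.lsmul ℝ ℝ, volume] f, ?_, fun x => ?_⟩
  · have h : ContDiff ℝ ∞ (φ.normed volume ⋆[ContinuousLinearMap.lsmul ℝ ℝ, volume] f) :=
      φ.hasCompactSupport_normed.contDiff_convolution_left _ hφ
        (hf.continuous.locallyIntegrable (μ := volume))
    exact_mod_cast contDiff_infty.1 h 2
  · have hd := hc.hasFDerivAt_convolution_right (ContinuousLinearMap.lsmul ℝ ℝ)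
      ((φ.continuous_normed (μ := volume)).locallyIntegrable (μ := volume)) hf x
    have heq : (φ.normed volume ⋆[(ContinuousLinearMap.lsmul ℝ ℝ).precompR X, volume]
        fderiv ℝ f) x =
        (φ.normed volume ⋆[ContinuousLinearMap.lsmul ℝ ℝ, volume] fderiv ℝ f) x := rfl
    rw [hd.fderiv, heq, ← dist_eq_norm]
    exact φ.dist_normed_convolution_le
      (hf.continuous_fderiv one_ne_zero).aestronglyMeasurable
      fun y hy => (hδ' (by simpa using hy)).le

end Mollification

section Stokes

variable {d : ℕ} {K : Set (E (d + 1))} {ν : E (d + 1) → E (d + 1)}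

lemma integral_normal_coord_eq_zero (hKconv : Convex ℝ K) (hK : IsCompact K)
    (hKint : (interior K).Nonempty) (hcont : ContinuousOn ν (frontier K))
    (hunit : ∀ x ∈ frontier K, ‖ν x‖ = 1)
    (houter : ∀ x ∈ frontier K, ∀ y ∈ K, ⟪y - x, ν x⟫ ≤ 0) (i : Fin (d + 1)) :
    ∫ x in frontier K, ν x i ∂μH[d] = 0 := by
  obtain ⟨c, hc⟩ := exists_gauss_green hKconv hK hKint hcont hunit houter
  simpa using hc i (fun _ => 1) contDiff_const

lemma integral_normal_eq_zero (hKconv : Convex ℝ K) (hK : IsCompact K)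
    (hKint : (interior K).Nonempty) (hcont : ContinuousOn ν (frontier K))
    (hunit : ∀ x ∈ frontier K, ‖ν x‖ = 1)
    (houter : ∀ x ∈ frontier K, ∀ y ∈ K, ⟪y - x, ν x⟫ ≤ 0) (u : E (d + 1)) :
    ∫ x in frontier K, ⟪ν x, u⟫ ∂μH[d] = 0 := by
  simp only [PiLp.inner_apply]
  rw [integral_finsetSum]
  · refine Finset.sum_eq_zero fun i _ => ?_
    simp only [RCLike.inner_apply, conj_trivial]
    rw [integral_const_mul, integral_normal_coord_eq_zero hKconv hK hKint hcont hunit houter i,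
      mul_zero]
  · intro i _
    simp only [RCLike.inner_apply, conj_trivial]
    exact (integrableOn_frontier hK hcont hunit houter
      ((EuclideanSpace.proj i).continuous.comp_continuousOn hcont)).const_mul _

lemma integral_stokes_coord_of_contDiff_two (hKconv : Convex ℝ K) (hK : IsCompact K)
    (hKint : (interior K).Nonempty) (hcont : ContinuousOn ν (frontier K))
    (hunit : ∀ x ∈ frontier K, ‖ν x‖ = 1)
    (houter : ∀ x ∈ frontier K, ∀ y ∈ K, ⟪y - x, ν x⟫ ≤ 0) (i j : Fin (d + 1))
    {f : E (d + 1) → ℝ} (hf : ContDiff ℝ 2 f) :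
    ∫ x in frontier K, (ν x i * fderiv ℝ f x (EuclideanSpace.single j 1) -
      ν x j * fderiv ℝ f x (EuclideanSpace.single i 1)) ∂μH[d] = 0 := by
  obtain ⟨c, hc⟩ := exists_gauss_green hKconv hK hKint hcont hunit houter
  have hdf : ContDiff ℝ 1 (fderiv ℝ f) := hf.fderiv_right (by norm_num)
  have hν : ∀ k, ContinuousOn (fun x => ν x k) (frontier K) := fun k =>
    (EuclideanSpace.proj k).continuous.comp_continuousOn hcont
  have hd : ∀ k, ContDiff ℝ 1 fun x => fderiv ℝ f x (EuclideanSpace.single k 1) := fun k =>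
    hdf.clm_apply contDiff_const
  have hint : ∀ k l, IntegrableOn (fun x => ν x k * fderiv ℝ f x (EuclideanSpace.single l 1))
      (frontier K) μH[d] := fun k l =>
    integrableOn_frontier hK hcont hunit houter ((hν k).mul (hd l).continuous.continuousOn)
  rw [integral_sub (hint i j) (hint j i), hc i _ (hd j), hc j _ (hd i), sub_eq_zero]
  congr 1
  refine integral_congr_ae (Eventually.of_forall fun x => ?_)
  have hsymm : IsSymmSndFDerivAt ℝ f x := hf.contDiffAt.isSymmSndFDerivAt (by simp)
  have happ : ∀ u v : E (d + 1), fderiv ℝ (fun x => fderiv ℝ f x u) x v =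
      fderiv ℝ (fderiv ℝ f) x v u := fun u v => by
    rw [fderiv_clm_apply (hdf.differentiable one_ne_zero x) (differentiableAt_const u)]
    simp
  simp only [happ]
  exact hsymm _ _

lemma integral_stokes_coord_of_hasCompactSupport (hKconv : Convex ℝ K) (hK : IsCompact K)
    (hKint : (interior K).Nonempty) (hcont : ContinuousOn ν (frontier K))
    (hunit : ∀ x ∈ frontier K, ‖ν x‖ = 1)
    (houter : ∀ x ∈ frontier K, ∀ y ∈ K, ⟪y - x, ν x⟫ ≤ 0) (i j : Fin (d + 1))
    {f : E (d + 1) → ℝ} (hf : ContDiff ℝ 1 f) (hc : HasCompactSupport f) :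
    ∫ x in frontier K, (ν x i * fderiv ℝ f x (EuclideanSpace.single j 1) -
      ν x j * fderiv ℝ f x (EuclideanSpace.single i 1)) ∂μH[d] = 0 := by
  have hfin := hausdorffMeasure_frontier_lt_top hK hcont hunit houter
  have hν : ∀ k, ContinuousOn (fun x => ν x k) (frontier K) := fun k =>
    (EuclideanSpace.proj k).continuous.comp_continuousOn hcont
  have hint : ∀ {g : E (d + 1) → ℝ}, ContDiff ℝ 1 g → IntegrableOn
      (fun x => ν x i * fderiv ℝ g x (EuclideanSpace.single j 1) -
        ν x j * fderiv ℝ g x (EuclideanSpace.single i 1)) (frontier K) μH[d] := fun hg =>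
    integrableOn_frontier hK hcont hunit houter
      (((hν i).mul ((hg.continuous_fderiv one_ne_zero).clm_apply
        continuous_const).continuousOn).sub
      ((hν j).mul ((hg.continuous_fderiv one_ne_zero).clm_apply
        continuous_const).continuousOn))
  set m := (μH[d] : Measure (E (d + 1))).real (frontier K)
  have hbound : ∀ ε > 0, ‖∫ x in frontier K,
      (ν x i * fderiv ℝ f x (EuclideanSpace.single j 1) -
      ν x j * fderiv ℝ f x (EuclideanSpace.single i 1)) ∂μH[d]‖ ≤ (ε + ε) * m := by
    intro ε hε
    obtain ⟨g, hg, hgf⟩ := exists_contDiff_fderiv_sub_le hf hc hε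
    rw [← norm_neg, ← zero_sub,
      ← integral_stokes_coord_of_contDiff_two hKconv hK hKint hcont hunit houter i j hg,
      ← integral_sub (hint (hg.of_le (by norm_num))) (hint hf)]
    refine norm_setIntegral_le_of_norm_le_const hfin fun x hx => ?_
    have h1 : ∀ k l, ‖ν x k * (fderiv ℝ g x - fderiv ℝ f x) (EuclideanSpace.single l 1)‖ ≤ ε := by
      intro k l
      rw [norm_mul]
      have h2 : ‖ν x k‖ ≤ 1 := (PiLp.norm_apply_le (ν x) k).trans (hunit x hx).le
      have h3 := (fderiv ℝ g x - fderiv ℝ f x).le_opNorm (EuclideanSpace.single l (1 : ℝ))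
      rw [PiLp.norm_single, norm_one, mul_one] at h3
      calc _ ≤ 1 * ε := mul_le_mul h2 (h3.trans (hgf x)) (norm_nonneg _) zero_le_one
        _ = ε := one_mul ε
    refine le_trans (le_of_eq ?_) ((norm_sub_le _ _).trans (add_le_add (h1 i j) (h1 j i)))
    congr 1
    simp only [sub_apply]
    ring
  refine norm_le_zero_iff.1 (ge_of_tendsto (f := fun ε : ℝ => (ε + ε) * m) (x := 𝓝[>] 0) ?_
    (eventually_mem_nhdsWithin.mono hbound))
  have : Tendsto (fun ε : ℝ => (ε + ε) * m) (𝓝 0) (𝓝 ((0 + 0) * m)) :=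
    ((tendsto_id.add tendsto_id).mul_const m)
  simpa using this.mono_left nhdsWithin_le_nhds

/-- Cutoff of a function of class `C¹` near a compact set. -/
lemma exists_contDiff_hasCompactSupport_eventuallyEq {m : ℕ} {M U : Set (E m)} (hM : IsCompact M)
    (hU : IsOpen U) (hMU : M ⊆ U) {f : E m → ℝ} (hf : ContDiffOn ℝ 1 f U) :
    ∃ g : E m → ℝ, ContDiff ℝ 1 g ∧ HasCompactSupport g ∧ ∀ x ∈ M, g =ᶠ[𝓝 x] f := by
  obtain ⟨t, ht, hMt, htU⟩ := exists_compact_between hM hU hMU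
  obtain ⟨χ, hχ1, hχ0, -⟩ := exists_contMDiffMap_one_nhds_of_subset_interior (n := 1)
    (modelWithCornersSelf ℝ (E m)) hM.isClosed hMt
  refine ⟨fun x => χ x * f x, contDiff_iff_contDiffAt.2 fun x => ?_,
    HasCompactSupport.intro ht fun x hx => by simp [hχ0 x hx], fun x hx => ?_⟩
  · by_cases hx : x ∈ U
    · exact χ.contMDiff.contDiff.contDiffAt.mul (hf.contDiffAt (hU.mem_nhds hx))
    · have h : (fun x => χ x * f x) =ᶠ[𝓝 x] fun _ => 0 :=
        eventually_of_mem (ht.isClosed.isOpen_compl.mem_nhds fun h => hx (htU h)) fun y hy => by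
          simp [hχ0 y hy]
      exact contDiffAt_const.congr_of_eventuallyEq h
  · filter_upwards [eventually_nhdsSet_iff_forall.1 hχ1 x hx] with y hy
    simp [hy]

lemma inner_mul_apply_sub_eq_sum {m : ℕ} (v a b : E m) (L : E m →L[ℝ] ℝ) :
    ⟪v, a⟫ * L b - ⟪v, b⟫ * L a = ∑ i, ∑ j, a i * b j *
      (v i * L (EuclideanSpace.single j 1) - v j * L (EuclideanSpace.single i 1)) := by
  have hL : ∀ c : E m, L c = ∑ j, c j * L (EuclideanSpace.single j 1) := fun c => by
    conv_lhs => rw [← (EuclideanSpace.basisFun (Fin m) ℝ).sum_repr c]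
    simp
  have hv : ∀ c : E m, ⟪v, c⟫ = ∑ j, c j * v j := fun c => by
    simp [PiLp.inner_apply]
  simp only [mul_sub, Finset.sum_sub_distrib]
  rw [hL a, hL b, hv a, hv b, Finset.sum_mul_sum, Finset.sum_mul_sum]
  congr 1
  · exact Finset.sum_congr rfl fun i _ => Finset.sum_congr rfl fun j _ => by ring
  · rw [Finset.sum_comm]
    exact Finset.sum_congr rfl fun i _ => Finset.sum_congr rfl fun j _ => by ring

/-- Stokes' theorem on the boundary of a convex body: tangential rotation fields
`⟪ν, a⟫ ∂_b - ⟪ν, b⟫ ∂_a` integrate to zero. -/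
theorem integral_stokes (hKconv : Convex ℝ K) (hK : IsCompact K)
    (hKint : (interior K).Nonempty) (hcont : ContinuousOn ν (frontier K))
    (hunit : ∀ x ∈ frontier K, ‖ν x‖ = 1)
    (houter : ∀ x ∈ frontier K, ∀ y ∈ K, ⟪y - x, ν x⟫ ≤ 0) {U : Set (E (d + 1))}
    (hU : IsOpen U) (hKU : frontier K ⊆ U) {f : E (d + 1) → ℝ} (hf : ContDiffOn ℝ 1 f U)
    (a b : E (d + 1)) :
    ∫ x in frontier K, (⟪ν x, a⟫ * fderiv ℝ f x b - ⟪ν x, b⟫ * fderiv ℝ f x a) ∂μH[d] = 0 := by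
  obtain ⟨g, hg, hgc, hgf⟩ := exists_contDiff_hasCompactSupport_eventuallyEq
    (hK.of_isClosed_subset isClosed_frontier hK.isClosed.frontier_subset) hU hKU hf
  have hcongr : ∀ x ∈ frontier K, fderiv ℝ f x = fderiv ℝ g x := fun x hx =>
    (hgf x hx).fderiv_eq.symm
  have hν : ∀ k, ContinuousOn (fun x => ν x k) (frontier K) := fun k =>
    (EuclideanSpace.proj k).continuous.comp_continuousOn hcont
  have hd : ∀ k, ContinuousOn (fun x => fderiv ℝ g x (EuclideanSpace.single k 1))
      (frontier K) := fun k =>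
    ((hg.continuous_fderiv one_ne_zero).clm_apply continuous_const).continuousOn
  have hint : ∀ i j, IntegrableOn (fun x => a i * b j *
      (ν x i * fderiv ℝ g x (EuclideanSpace.single j 1) -
        ν x j * fderiv ℝ g x (EuclideanSpace.single i 1))) (frontier K) μH[d] := fun i j =>
    integrableOn_frontier hK hcont hunit houter
      (continuousOn_const.mul (((hν i).mul (hd j)).sub ((hν j).mul (hd i))))
  rw [setIntegral_congr_fun isClosed_frontier.measurableSet fun x hx => by
    rw [hcongr x hx, inner_mul_apply_sub_eq_sum]]
  rw [integral_finsetSum _ fun i _ => integrable_finsetSum _ fun j _ => hint i j]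
  refine Finset.sum_eq_zero fun i _ => ?_
  rw [integral_finsetSum _ fun j _ => hint i j]
  refine Finset.sum_eq_zero fun j _ => ?_
  rw [integral_const_mul, integral_stokes_coord_of_hasCompactSupport hKconv hK hKint hcont hunit
    houter i j hg hgc, mul_zero]

end Stokes

section Weingarten

open scoped ContDiff

variable {d : ℕ} {K : Set (E (d + 1))} {ν : E (d + 1) → E (d + 1)} {U : Set (E (d + 1))}

lemma ae_eq_zero_of_forall_integral_mul_eq_zero (hK : IsCompact K)
    (hcont : ContinuousOn ν (frontier K))
    (hunit : ∀ x ∈ frontier K, ‖ν x‖ = 1)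
    (houter : ∀ x ∈ frontier K, ∀ y ∈ K, ⟪y - x, ν x⟫ ≤ 0)
    {h : E (d + 1) → ℝ} (hh : ContinuousOn h (frontier K))
    (H : ∀ φ : E (d + 1) → ℝ, ContDiff ℝ 1 φ → ∫ x in frontier K, φ x * h x ∂μH[d] = 0) :
    ∀ᵐ x ∂(μH[d] : Measure (E (d + 1))).restrict (frontier K), h x = 0 :=
  ae_eq_zero_of_integral_contDiff_smul_eq_zero
    (integrableOn_frontier hK hcont hunit houter hh).integrable.locallyIntegrable
    fun φ hφ _ => by simpa using H φ (hφ.of_le (mod_cast le_top))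

lemma continuousOn_inner_fderiv (hU : IsOpen U) (hKU : frontier K ⊆ U)
    (hν : ContDiffOn ℝ 1 ν U) (b c : E (d + 1)) :
    ContinuousOn (fun x => ⟪fderiv ℝ ν x b, c⟫) (frontier K) :=
  (((hν.continuousOn_fderiv_of_isOpen hU le_rfl).mono hKU).clm_apply
    continuousOn_const).inner continuousOn_const

lemma ae_inner_fderiv_normal (hKconv : Convex ℝ K) (hK : IsCompact K)
    (hKint : (interior K).Nonempty) (hU : IsOpen U) (hKU : frontier K ⊆ U)
    (hν : ContDiffOn ℝ 1 ν U) (hunit : ∀ x ∈ frontier K, ‖ν x‖ = 1)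
    (houter : ∀ x ∈ frontier K, ∀ y ∈ K, ⟪y - x, ν x⟫ ≤ 0) (a b : E (d + 1)) :
    ∀ᵐ x ∂(μH[d] : Measure (E (d + 1))).restrict (frontier K),
      ⟪ν x, a⟫ * ⟪fderiv ℝ ν x b, ν x⟫ - ⟪ν x, b⟫ * ⟪fderiv ℝ ν x a, ν x⟫ = 0 := by
  have hcont : ContinuousOn ν (frontier K) := hν.continuousOn.mono hKU
  have hD := (hν.continuousOn_fderiv_of_isOpen hU le_rfl).mono hKU
  have hDv : ∀ v, ContinuousOn (fun x => ⟪fderiv ℝ ν x v, ν x⟫) (frontier K) := fun v =>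
    (hD.clm_apply continuousOn_const).inner hcont
  have hνv : ∀ v, ContinuousOn (fun x => ⟪ν x, v⟫) (frontier K) := fun v =>
    hcont.inner continuousOn_const
  have hh : ContinuousOn (fun x => ⟪ν x, a⟫ * ⟪fderiv ℝ ν x b, ν x⟫ -
      ⟪ν x, b⟫ * ⟪fderiv ℝ ν x a, ν x⟫) (frontier K) :=
    ((hνv a).mul (hDv b)).sub ((hνv b).mul (hDv a))
  refine ae_eq_zero_of_forall_integral_mul_eq_zero hK hcont hunit houter hh fun φ hφ => ?_
  have h1 := integral_stokes hKconv hK hKint hcont hunit houter hU hKU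
    (hφ.contDiffOn.mul (hν.inner ℝ hν)) a b
  have h2 := integral_stokes hKconv hK hKint hcont hunit houter hU hKU hφ.contDiffOn a b
  have hφv : ∀ v, ContinuousOn (fun x => fderiv ℝ φ x v) (frontier K) := fun v =>
    ((hφ.continuous_fderiv one_ne_zero).clm_apply continuous_const).continuousOn
  have hcongr : EqOn (fun x => ⟪ν x, a⟫ * fderiv ℝ (fun x => φ x * ⟪ν x, ν x⟫) x b -
      ⟪ν x, b⟫ * fderiv ℝ (fun x => φ x * ⟪ν x, ν x⟫) x a)
      (fun x => 2 * (φ x * (⟪ν x, a⟫ * ⟪fderiv ℝ ν x b, ν x⟫ -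
        ⟪ν x, b⟫ * ⟪fderiv ℝ ν x a, ν x⟫)) +
        (⟪ν x, a⟫ * fderiv ℝ φ x b - ⟪ν x, b⟫ * fderiv ℝ φ x a)) (frontier K) := by
    intro x hx
    have hνx : DifferentiableAt ℝ ν x :=
      (hν.contDiffAt (hU.mem_nhds (hKU hx))).differentiableAt one_ne_zero
    have hf : ∀ v, fderiv ℝ (fun x => φ x * ⟪ν x, ν x⟫) x v =
        2 * (φ x * ⟪fderiv ℝ ν x v, ν x⟫) + fderiv ℝ φ x v := fun v => by
      rw [fderiv_fun_mul (hφ.differentiable one_ne_zero x) (hνx.inner ℝ hνx)]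
      simp only [add_apply, smul_apply, smul_eq_mul, fderiv_inner_apply ℝ hνx hνx]
      rw [real_inner_self_eq_norm_sq, hunit x hx, real_inner_comm (fderiv ℝ ν x v)]
      ring
    simp only [hf]
    ring
  have hi1 : IntegrableOn (fun x => φ x * (⟪ν x, a⟫ * ⟪fderiv ℝ ν x b, ν x⟫ -
      ⟪ν x, b⟫ * ⟪fderiv ℝ ν x a, ν x⟫)) (frontier K) μH[d] :=
    integrableOn_frontier hK hcont hunit houter (hφ.continuous.continuousOn.mul hh)
  have hi2 : IntegrableOn (fun x => ⟪ν x, a⟫ * fderiv ℝ φ x b - ⟪ν x, b⟫ * fderiv ℝ φ x a)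
      (frontier K) μH[d] :=
    integrableOn_frontier hK hcont hunit houter (((hνv a).mul (hφv b)).sub ((hνv b).mul (hφv a)))
  rw [setIntegral_congr_fun isClosed_frontier.measurableSet hcongr,
    integral_add (hi1.const_mul 2) hi2, h2, add_zero, integral_const_mul] at h1
  linarith

lemma ae_cyclic_inner_fderiv (hKconv : Convex ℝ K) (hK : IsCompact K)
    (hKint : (interior K).Nonempty) (hU : IsOpen U) (hKU : frontier K ⊆ U)
    (hν : ContDiffOn ℝ 1 ν U) (hunit : ∀ x ∈ frontier K, ‖ν x‖ = 1)
    (houter : ∀ x ∈ frontier K, ∀ y ∈ K, ⟪y - x, ν x⟫ ≤ 0) (a b c : E (d + 1)) :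
    ∀ᵐ x ∂(μH[d] : Measure (E (d + 1))).restrict (frontier K),
      (⟪ν x, a⟫ * ⟪fderiv ℝ ν x b, c⟫ - ⟪ν x, b⟫ * ⟪fderiv ℝ ν x a, c⟫) +
      (⟪ν x, b⟫ * ⟪fderiv ℝ ν x c, a⟫ - ⟪ν x, c⟫ * ⟪fderiv ℝ ν x b, a⟫) +
      (⟪ν x, c⟫ * ⟪fderiv ℝ ν x a, b⟫ - ⟪ν x, a⟫ * ⟪fderiv ℝ ν x c, b⟫) = 0 := by
  have hcont : ContinuousOn ν (frontier K) := hν.continuousOn.mono hKU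
  have hDv := continuousOn_inner_fderiv hU hKU hν
  have hνv : ∀ v, ContinuousOn (fun x => ⟪ν x, v⟫) (frontier K) := fun v =>
    hcont.inner continuousOn_const
  have hh : ∀ a b c, ContinuousOn (fun x => ⟪ν x, a⟫ * ⟪fderiv ℝ ν x b, c⟫ -
      ⟪ν x, b⟫ * ⟪fderiv ℝ ν x a, c⟫) (frontier K) := fun a b c =>
    ((hνv a).mul (hDv b c)).sub ((hνv b).mul (hDv a c))
  refine ae_eq_zero_of_forall_integral_mul_eq_zero hK hcont hunit houter
    (((hh a b c).add (hh b c a)).add (hh c a b)) fun φ hφ => ?_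
  have h := fun a b c => integral_stokes hKconv hK hKint hcont hunit houter hU hKU
    (hφ.contDiffOn.mul (hν.inner ℝ (contDiffOn_const (c := c)))) a b
  have hφv : ∀ v, ContinuousOn (fun x => fderiv ℝ φ x v) (frontier K) := fun v =>
    ((hφ.continuous_fderiv one_ne_zero).clm_apply continuous_const).continuousOn
  have hcongr : ∀ a b c, EqOn (fun x => ⟪ν x, a⟫ * fderiv ℝ (fun x => φ x * ⟪ν x, c⟫) x b -
      ⟪ν x, b⟫ * fderiv ℝ (fun x => φ x * ⟪ν x, c⟫) x a)
      (fun x => φ x * (⟪ν x, a⟫ * ⟪fderiv ℝ ν x b, c⟫ - ⟪ν x, b⟫ * ⟪fderiv ℝ ν x a, c⟫) +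
        ⟪ν x, c⟫ * (⟪ν x, a⟫ * fderiv ℝ φ x b - ⟪ν x, b⟫ * fderiv ℝ φ x a)) (frontier K) := by
    intro a b c x hx
    have hνx : DifferentiableAt ℝ ν x :=
      (hν.contDiffAt (hU.mem_nhds (hKU hx))).differentiableAt one_ne_zero
    have hf : ∀ v, fderiv ℝ (fun x => φ x * ⟪ν x, c⟫) x v =
        φ x * ⟪fderiv ℝ ν x v, c⟫ + ⟪ν x, c⟫ * fderiv ℝ φ x v := fun v => by
      rw [fderiv_fun_mul (hφ.differentiable one_ne_zero x)
        (hνx.inner ℝ (differentiableAt_const c))]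
      simp [fderiv_inner_apply ℝ hνx (differentiableAt_const c)]
    simp only [hf]
    ring
  have hint : ∀ a b c, IntegrableOn (fun x => φ x *
      (⟪ν x, a⟫ * ⟪fderiv ℝ ν x b, c⟫ - ⟪ν x, b⟫ * ⟪fderiv ℝ ν x a, c⟫) +
        ⟪ν x, c⟫ * (⟪ν x, a⟫ * fderiv ℝ φ x b - ⟪ν x, b⟫ * fderiv ℝ φ x a))
      (frontier K) μH[d] := fun a b c =>
    integrableOn_frontier hK hcont hunit houter
      ((hφ.continuous.continuousOn.mul (hh a b c)).add
        ((hνv c).mul (((hνv a).mul (hφv b)).sub ((hνv b).mul (hφv a)))))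
  have h' := fun a b c => (setIntegral_congr_fun isClosed_frontier.measurableSet
    (hcongr a b c)).symm.trans (h a b c)
  have hint2 := (hint a b c).add (hint b c a)
  have hsum := congrArg₂ (· + ·) (congrArg₂ (· + ·) (h' a b c) (h' b c a)) (h' c a b)
  simp only [add_zero] at hsum
  rw [← integral_add' (hint a b c) (hint b c a), ← integral_add' hint2 (hint c a b)] at hsum
  rw [← hsum]
  refine integral_congr_ae (Eventually.of_forall fun x => ?_)
  simp only [Pi.add_apply]
  ring

/-- The differential of the normal field is almost everywhere tangential and symmetric on the
tangent hyperplane. -/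
theorem ae_fderiv_normal_tangent_symm (hKconv : Convex ℝ K) (hK : IsCompact K)
    (hKint : (interior K).Nonempty) (hU : IsOpen U) (hKU : frontier K ⊆ U)
    (hν : ContDiffOn ℝ 1 ν U) (hunit : ∀ x ∈ frontier K, ‖ν x‖ = 1)
    (houter : ∀ x ∈ frontier K, ∀ y ∈ K, ⟪y - x, ν x⟫ ≤ 0) :
    ∀ᵐ x ∂(μH[d] : Measure (E (d + 1))).restrict (frontier K),
      (∀ b, ⟪ν x, b⟫ = 0 → ⟪fderiv ℝ ν x b, ν x⟫ = 0) ∧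
      ∀ b c, ⟪ν x, b⟫ = 0 → ⟪ν x, c⟫ = 0 → ⟪fderiv ℝ ν x b, c⟫ = ⟪fderiv ℝ ν x c, b⟫ := by
  set e := TopologicalSpace.denseSeq (E (d + 1))
  have he : DenseRange e := TopologicalSpace.denseRange_denseSeq _
  have h1 := ae_all_iff.2 fun i => ae_all_iff.2 fun j =>
    ae_inner_fderiv_normal hKconv hK hKint hU hKU hν hunit houter (e i) (e j)
  have h2 := ae_all_iff.2 fun i => ae_all_iff.2 fun j => ae_all_iff.2 fun k =>
    ae_cyclic_inner_fderiv hKconv hK hKint hU hKU hν hunit houter (e i) (e j) (e k)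
  filter_upwards [h1, h2, ae_restrict_mem isClosed_frontier.measurableSet] with x hx1 hx2 hx
  have hνν : ⟪ν x, ν x⟫ = 1 := by rw [real_inner_self_eq_norm_sq, hunit x hx, one_pow]
  refine ⟨fun b hb => ?_, fun b c hb hc => ?_⟩
  · have := isClosed_property2 he (p := fun a b => ⟪ν x, a⟫ * ⟪fderiv ℝ ν x b, ν x⟫ -
      ⟪ν x, b⟫ * ⟪fderiv ℝ ν x a, ν x⟫ = 0) (isClosed_eq (by fun_prop) continuous_const)
      hx1 (ν x) b
    simpa only [hνν, hb, one_mul, zero_mul, sub_zero] using this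
  · have := isClosed_property3 he (p := fun a b c =>
      (⟪ν x, a⟫ * ⟪fderiv ℝ ν x b, c⟫ - ⟪ν x, b⟫ * ⟪fderiv ℝ ν x a, c⟫) +
      (⟪ν x, b⟫ * ⟪fderiv ℝ ν x c, a⟫ - ⟪ν x, c⟫ * ⟪fderiv ℝ ν x b, a⟫) +
      (⟪ν x, c⟫ * ⟪fderiv ℝ ν x a, b⟫ - ⟪ν x, a⟫ * ⟪fderiv ℝ ν x c, b⟫) = 0)
      (isClosed_eq (by fun_prop) continuous_const) hx2 (ν x) b c
    simp only [hνν, hb, hc] at this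
    linarith

end Weingarten

section TangentialAlgebra

variable {m : ℕ} {N e : E m} {D : E m →L[ℝ] E m}

lemma tproj_apply (u v : E m) : tproj u v = v - ⟪u, v⟫ • u := by
  simp [tproj]

lemma inner_tproj_right_of_norm_eq_one (hN : ‖N‖ = 1) (v : E m) : ⟪N, tproj N v⟫ = 0 := by
  rw [tproj_apply, inner_sub_right, real_inner_smul_right, real_inner_self_eq_norm_sq, hN]
  ring

lemma inner_tproj_eq_of_inner_eq_zero {v : E m} (hv : ⟪v, N⟫ = 0) (w : E m) :
    ⟪v, tproj N w⟫ = ⟪v, w⟫ := by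
  rw [tproj_apply, inner_sub_right, real_inner_smul_right, hv, mul_zero, sub_zero]

/-- The tangential part of the transpose of a tangential symmetric map. -/
lemma tproj_eq_apply_tproj (hN : ‖N‖ = 1) (htan : ∀ b, ⟪N, b⟫ = 0 → ⟪D b, N⟫ = 0)
    (hsymm : ∀ b c, ⟪N, b⟫ = 0 → ⟪N, c⟫ = 0 → ⟪D b, c⟫ = ⟪D c, b⟫) {g : E m}
    (hg : ∀ v, ⟪g, v⟫ = ⟪D v, e⟫) : tproj N g = D (tproj N e) := by
  have hP := inner_tproj_right_of_norm_eq_one hN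
  refine ext_inner_right ℝ fun v => ?_
  have h1 : ⟪tproj N g, v⟫ = ⟪g, tproj N v⟫ := by
    rw [tproj_apply, tproj_apply, inner_sub_left, inner_sub_right, real_inner_smul_left,
      real_inner_smul_right, real_inner_comm g N]
    ring
  rw [h1, hg, ← inner_tproj_eq_of_inner_eq_zero (htan _ (hP v)) e,
    hsymm _ _ (hP v) (hP e), inner_tproj_eq_of_inner_eq_zero (htan _ (hP e))]

lemma inner_eq_sum_mul (v w : E m) : ⟪v, w⟫ = ∑ j, v j * w j := by
  simp [PiLp.inner_apply, mul_comm]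

lemma inner_apply_left_eq_sum (L : E m →L[ℝ] E m) (v w : E m) :
    ⟪L v, w⟫ = ∑ j, v j * ⟪L (EuclideanSpace.single j 1), w⟫ := by
  conv_lhs => rw [← (EuclideanSpace.basisFun (Fin m) ℝ).sum_repr v]
  simp [sum_inner, real_inner_smul_left]

lemma trace_tproj_comp (hN : ‖N‖ = 1) :
    LinearMap.trace ℝ (E m) (((tproj N).comp (D.comp (tproj N))) : E m →ₗ[ℝ] E m) =
      ∑ j, D (EuclideanSpace.single j 1) j - ⟪D N, N⟫ := by
  have hNN : ⟪N, N⟫ = 1 := by rw [real_inner_self_eq_norm_sq, hN, one_pow]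
  have hterm : ∀ j, ⟪EuclideanSpace.single j (1 : ℝ),
      (tproj N).comp (D.comp (tproj N)) (EuclideanSpace.single j 1)⟫ =
      D (EuclideanSpace.single j 1) j - N j * D N j -
        N j * ⟪D (EuclideanSpace.single j 1), N⟫ + N j * N j * ⟪D N, N⟫ := fun j => by
    simp only [ContinuousLinearMap.comp_apply, tproj_apply, map_sub, map_smul,
      EuclideanSpace.inner_single_left, EuclideanSpace.inner_single_right, inner_sub_right,
      real_inner_comm N]
    simp
    ring
  rw [LinearMap.trace_eq_sum_inner _ (EuclideanSpace.basisFun (Fin m) ℝ)]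
  simp only [EuclideanSpace.basisFun_apply, ContinuousLinearMap.coe_coe, hterm,
    Finset.sum_add_distrib, Finset.sum_sub_distrib, ← Finset.sum_mul]
  rw [← inner_eq_sum_mul, ← inner_eq_sum_mul, ← inner_apply_left_eq_sum, hNN,
    real_inner_comm N]
  ring

lemma sum_stokes_integrand (hN : ‖N‖ = 1) (htan : ∀ b, ⟪N, b⟫ = 0 → ⟪D b, N⟫ = 0) :
    ∑ j, (⟪N, e⟫ * (⟪N, e⟫ * D (EuclideanSpace.single j 1) j +
        N j * ⟪D (EuclideanSpace.single j 1), e⟫) -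
      N j * (⟪N, e⟫ * D e j + N j * ⟪D e, e⟫)) =
    (∑ j, D (EuclideanSpace.single j 1) j - ⟪D N, N⟫) * ⟪N, e⟫ ^ 2 -
      ⟪D (tproj N e), tproj N e⟫ := by
  have hNN : ⟪N, N⟫ = 1 := by rw [real_inner_self_eq_norm_sq, hN, one_pow]
  have h0 := htan _ (inner_tproj_right_of_norm_eq_one hN e)
  have hsum : ∑ j, (⟪N, e⟫ * (⟪N, e⟫ * D (EuclideanSpace.single j 1) j +
        N j * ⟪D (EuclideanSpace.single j 1), e⟫) -
      N j * (⟪N, e⟫ * D e j + N j * ⟪D e, e⟫)) =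
      ⟪N, e⟫ ^ 2 * ∑ j, D (EuclideanSpace.single j 1) j + ⟪N, e⟫ * ⟪D N, e⟫ -
        ⟪N, e⟫ * ⟪N, D e⟫ - ⟪N, N⟫ * ⟪D e, e⟫ := by
    rw [inner_apply_left_eq_sum D N e, inner_eq_sum_mul N (D e), inner_eq_sum_mul N N,
      Finset.mul_sum, Finset.mul_sum, Finset.mul_sum, Finset.sum_mul, ← Finset.sum_add_distrib,
      ← Finset.sum_sub_distrib, ← Finset.sum_sub_distrib]
    exact Finset.sum_congr rfl fun j _ => by ring
  rw [hsum, inner_tproj_eq_of_inner_eq_zero h0]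
  rw [tproj_apply, map_sub, map_smul, inner_sub_left, real_inner_smul_left] at h0 ⊢
  rw [hNN, real_inner_comm (D e) N]
  linear_combination (-⟪N, e⟫) * h0

end TangentialAlgebra

section Equality

variable {d : ℕ} {K : Set (E (d + 1))} {ν : E (d + 1) → E (d + 1)} {U : Set (E (d + 1))}

lemma integral_mean_curvature_mul_sq (hKconv : Convex ℝ K) (hK : IsCompact K)
    (hKint : (interior K).Nonempty) (hU : IsOpen U) (hKU : frontier K ⊆ U)
    (hν : ContDiffOn ℝ 1 ν U) (hunit : ∀ x ∈ frontier K, ‖ν x‖ = 1)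
    (houter : ∀ x ∈ frontier K, ∀ y ∈ K, ⟪y - x, ν x⟫ ≤ 0) (e : E (d + 1)) :
    ∫ x in frontier K, (∑ j, fderiv ℝ ν x (EuclideanSpace.single j 1) j -
        ⟪fderiv ℝ ν x (ν x), ν x⟫) * ⟪ν x, e⟫ ^ 2 ∂μH[d] =
      ∫ x in frontier K, ⟪fderiv ℝ ν x (tproj (ν x) e), tproj (ν x) e⟫ ∂μH[d] := by
  have hcont : ContinuousOn ν (frontier K) := hν.continuousOn.mono hKU
  have hD := (hν.continuousOn_fderiv_of_isOpen hU le_rfl).mono hKU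
  have hνj : ∀ j, ContDiffOn ℝ 1 (fun x => ν x j) U := fun j =>
    (EuclideanSpace.proj (𝕜 := ℝ) j).contDiff.comp_contDiffOn hν
  have hνe : ContinuousOn (fun x => ⟪ν x, e⟫) (frontier K) := hcont.inner continuousOn_const
  have hcoord : ∀ (j) {g : E (d + 1) → E (d + 1)}, ContinuousOn g (frontier K) →
      ContinuousOn (fun x => g x j) (frontier K) := fun j _ hg =>
    (EuclideanSpace.proj j).continuous.comp_continuousOn hg
  have hP : ContinuousOn (fun x => tproj (ν x) e) (frontier K) := by
    simp only [tproj_apply]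
    exact continuousOn_const.sub (hνe.smul hcont)
  have hA : IntegrableOn (fun x => (∑ j, fderiv ℝ ν x (EuclideanSpace.single j 1) j -
        ⟪fderiv ℝ ν x (ν x), ν x⟫) * ⟪ν x, e⟫ ^ 2) (frontier K) μH[d] :=
    integrableOn_frontier hK hcont hunit houter <|
      ((continuousOn_finsetSum _ fun j _ => hcoord j (hD.clm_apply continuousOn_const)).sub
        ((hD.clm_apply hcont).inner hcont)).mul (hνe.pow 2)
  have hB : IntegrableOn (fun x => ⟪fderiv ℝ ν x (tproj (ν x) e), tproj (ν x) e⟫)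
      (frontier K) μH[d] :=
    integrableOn_frontier hK hcont hunit houter ((hD.clm_apply hP).inner hP)
  have hS : ∀ j, IntegrableOn (fun x => ⟪ν x, e⟫ *
      (⟪ν x, e⟫ * fderiv ℝ ν x (EuclideanSpace.single j 1) j +
        ν x j * ⟪fderiv ℝ ν x (EuclideanSpace.single j 1), e⟫) -
      ν x j * (⟪ν x, e⟫ * fderiv ℝ ν x e j + ν x j * ⟪fderiv ℝ ν x e, e⟫))
      (frontier K) μH[d] := fun j => by
    have h1 : ∀ v, ContinuousOn (fun x => fderiv ℝ ν x v) (frontier K) := fun v =>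
      hD.clm_apply continuousOn_const
    have h2 := fun v => (h1 v).inner (𝕜 := ℝ) (continuousOn_const (c := e))
    exact integrableOn_frontier hK hcont hunit houter
      ((hνe.mul ((hνe.mul (hcoord j (h1 _))).add ((hcoord j hcont).mul (h2 _)))).sub
      ((hcoord j hcont).mul ((hνe.mul (hcoord j (h1 e))).add ((hcoord j hcont).mul (h2 e)))))
  rw [← sub_eq_zero, ← integral_sub hA hB]
  have hae := ae_fderiv_normal_tangent_symm hKconv hK hKint hU hKU hν hunit houter
  have hcongr : ∀ᵐ x ∂(μH[d] : Measure (E (d + 1))).restrict (frontier K),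
      (∑ j, fderiv ℝ ν x (EuclideanSpace.single j 1) j -
        ⟪fderiv ℝ ν x (ν x), ν x⟫) * ⟪ν x, e⟫ ^ 2 -
        ⟪fderiv ℝ ν x (tproj (ν x) e), tproj (ν x) e⟫ =
      ∑ j, (⟪ν x, e⟫ * (⟪ν x, e⟫ * fderiv ℝ ν x (EuclideanSpace.single j 1) j +
        ν x j * ⟪fderiv ℝ ν x (EuclideanSpace.single j 1), e⟫) -
      ν x j * (⟪ν x, e⟫ * fderiv ℝ ν x e j + ν x j * ⟪fderiv ℝ ν x e, e⟫)) := by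
    filter_upwards [hae, ae_restrict_mem isClosed_frontier.measurableSet] with x hx hxK
    exact (sum_stokes_integrand (hunit x hxK) hx.1).symm
  rw [integral_congr_ae hcongr, integral_finsetSum _ fun j _ => hS j]
  refine Finset.sum_eq_zero fun j _ => ?_
  have h := integral_stokes hKconv hK hKint hcont hunit houter hU hKU
    ((hν.inner ℝ (contDiffOn_const (c := e))).mul (hνj j)) e (EuclideanSpace.single j 1)
  rw [← h]
  refine setIntegral_congr_fun isClosed_frontier.measurableSet fun x hx => ?_
  have hνx : DifferentiableAt ℝ ν x :=
    (hν.contDiffAt (hU.mem_nhds (hKU hx))).differentiableAt one_ne_zero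
  have hνjx : HasFDerivAt (fun x => ν x j)
      ((EuclideanSpace.proj (𝕜 := ℝ) j).comp (fderiv ℝ ν x)) x :=
    (EuclideanSpace.proj (𝕜 := ℝ) j).hasFDerivAt.comp x hνx.hasFDerivAt
  have hf : ∀ v, fderiv ℝ (fun x => ⟪ν x, e⟫ * ν x j) x v =
      ⟪ν x, e⟫ * fderiv ℝ ν x v j + ν x j * ⟪fderiv ℝ ν x v, e⟫ := fun v => by
    rw [fderiv_fun_mul (hνx.inner ℝ (differentiableAt_const e)) hνjx.differentiableAt,
      hνjx.fderiv]
    simp [fderiv_inner_apply ℝ hνx (differentiableAt_const e)]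
  simp only [hf, EuclideanSpace.inner_single_right]
  simp

end Equality

end ConvexBodies

/-- Sharpness of the main theorem:  Let `K ⊂ ℝⁿ` be a convex body of class `C²₊`
(compact convex set with nonempty interior, whose outer unit normal field `ν` is `C¹`
near `∂K`, with positive definite Weingarten map), let `W x` be the inverse of the
Weingarten map on the tangent space at `x`, let `u₀ ∈ ℝⁿ` be a fixed vector, and let
`ψ(x) = ⟨ν(x), u₀⟩` for `x ∈ ∂K`.  Then `∫_{∂K} ψ dℋ^{n-1} = 0` and equality holds in
the main inequality:
`∫_{∂K} tr(Dν) ψ² dℋ^{n-1} = ∫_{∂K} ⟨(Dν)⁻¹ ∇ψ, ∇ψ⟩ dℋ^{n-1}`,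
where `∇ψ x = tproj (ν x) (gradient ψ x)` is the tangential gradient of `ψ` on `∂K`. -/
theorem equality_case
    {n : ℕ} (hn : 2 ≤ n) (K : Set (E n))
    (hKconv : Convex ℝ K) (hKcomp : IsCompact K) (hKint : (interior K).Nonempty)
    (ν : E n → E n) (U : Set (E n)) (hU : IsOpen U) (hKU : frontier K ⊆ U)
    (hνC1 : ContDiffOn ℝ 1 ν U)
    (hνunit : ∀ x ∈ frontier K, ‖ν x‖ = 1)
    (hνouter : ∀ x ∈ frontier K, ∀ y ∈ K, ⟪y - x, ν x⟫ ≤ 0)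
    (hcurv : ∀ x ∈ frontier K, ∀ v ∈ (ℝ ∙ (ν x))ᗮ, v ≠ 0 → 0 < ⟪fderiv ℝ ν x v, v⟫)
    (W : E n → E n →L[ℝ] E n)
    (hWtan : ∀ x ∈ frontier K, ∀ v : E n, W x v ∈ (ℝ ∙ (ν x))ᗮ)
    (hWinv : ∀ x ∈ frontier K, ∀ v : E n,
      W x (fderiv ℝ ν x (tproj (ν x) v)) = tproj (ν x) v)
    (u₀ : E n) (ψ : E n → ℝ) (hψdef : ∀ x, ψ x = ⟪ν x, u₀⟫) :
    (∫ x in frontier K, ψ x ∂μH[(n : ℝ) - 1]) = 0 ∧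
    (∫ x in frontier K,
        (LinearMap.trace ℝ (E n)
          (((tproj (ν x)).comp ((fderiv ℝ ν x).comp (tproj (ν x)))) : E n →ₗ[ℝ] E n))
          * (ψ x) ^ 2 ∂μH[(n : ℝ) - 1])
      = ∫ x in frontier K,
          ⟪W x (tproj (ν x) (gradient ψ x)), tproj (ν x) (gradient ψ x)⟫
            ∂μH[(n : ℝ) - 1] := by
  obtain ⟨d, rfl⟩ : ∃ d, n = d + 1 := ⟨n - 1, by omega⟩
  have hdim : ((d + 1 : ℕ) : ℝ) - 1 = d := by push_cast; ring
  have hcont : ContinuousOn ν (frontier K) := hνC1.continuousOn.mono hKU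
  have hmeas : MeasurableSet (frontier K) := isClosed_frontier.measurableSet
  simp only [hdim]
  refine ⟨?_, ?_⟩
  · simp only [hψdef]
    exact integral_normal_eq_zero hKconv hKcomp hKint hcont hνunit hνouter u₀
  · rw [setIntegral_congr_fun hmeas fun x hx => by
      simp only [trace_tproj_comp (D := fderiv ℝ ν x) (hνunit x hx), hψdef]; rfl,
      integral_mean_curvature_mul_sq hKconv hKcomp hKint hU hKU hνC1 hνunit hνouter u₀]
    refine integral_congr_ae ?_
    filter_upwards [ae_fderiv_normal_tangent_symm hKconv hKcomp hKint hU hKU hνC1 hνunit hνouter,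
      ae_restrict_mem hmeas] with x hx hxK
    have hνx : DifferentiableAt ℝ ν x :=
      (hνC1.contDiffAt (hU.mem_nhds (hKU hxK))).differentiableAt one_ne_zero
    have hg : ∀ v, ⟪gradient ψ x, v⟫ = ⟪fderiv ℝ ν x v, u₀⟫ := fun v => by
      rw [funext hψdef, gradient, InnerProductSpace.toDual_symm_apply,
        fderiv_inner_apply ℝ hνx (differentiableAt_const u₀)]
      simp
    rw [tproj_eq_apply_tproj (hνunit x hxK) hx.1 hx.2 hg, hWinv x hxK, real_inner_comm]
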